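/- arXiv:2508.19041 — 2 statements merged into one kernel-verified Lean document; each statement's English description precedes it below -/
import Mathlib

section
/- For every g ≥ 2, the ℚ-vector space of GL(H)-equivariant linear maps π : C₁₂^{(4)} → Λ⁴H satisfying π(GC3(t,u,v,w)) = 0 for all t,u,v,w ∈ T with deg t + deg u + deg v + deg w = 4 (equivalently, those π that factor through the 2-loop space Ω̃₂^{(4)} = C₁₂^{(4)}/span of the GC3 elements) has dimension 2. (Dimensional form of Lemma 4.3 of the paper.) -/
open TensorProduct

set_option maxSynthPendingDepth 4

noncomputable section

/-- The symplectic vector space `H = ℚ^{2g}`. -/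
abbrev Hsp (g : ℕ) : Type := Fin (2 * g) → ℚ

/-- The tensor algebra `T = T(H)`. -/
abbrev TA (g : ℕ) : Type := TensorAlgebra ℚ (Hsp g)

/-- The antipode `x ↦ x̄`, determined by `overline (u₁⋯u_m) = (−1)^m u_m⋯u₁`. -/
def barT (g : ℕ) : TA g →ₗ[ℚ] TA g :=
  (MulOpposite.opLinearEquiv ℚ (M := TA g)).symm.toLinearMap ∘ₗ
    (TensorAlgebra.lift ℚ
      ((MulOpposite.opLinearEquiv ℚ (M := TA g)).toLinearMap ∘ₗ
        (-(TensorAlgebra.ι ℚ (M := Hsp g))))).toLinearMap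

/-- The coproduct `Δ : T → T ⊗ T`, the algebra homomorphism with
`Δ(u) = u ⊗ 1 + 1 ⊗ u` for `u ∈ H`. -/
def comul (g : ℕ) : TA g →ₗ[ℚ] TA g ⊗[ℚ] TA g :=
  (TensorAlgebra.lift ℚ
    (((TensorProduct.mk ℚ (TA g) (TA g)).flip 1) ∘ₗ TensorAlgebra.ι ℚ
      + (TensorProduct.mk ℚ (TA g) (TA g) 1) ∘ₗ TensorAlgebra.ι ℚ)).toLinearMap

/-- `T ⊗ T ⊗ T ⊗ T`. -/
abbrev T4 (g : ℕ) : Type := TA g ⊗[ℚ] (TA g ⊗[ℚ] (TA g ⊗[ℚ] TA g))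

/-- The generator `Θ(t,u,v,w)`, i.e. `t ⊗ u ⊗ v ⊗ w`. -/
def Th (g : ℕ) (t u v w : TA g) : T4 g := t ⊗ₜ[ℚ] (u ⊗ₜ[ℚ] (v ⊗ₜ[ℚ] w))

/-- The second term `Θ(t̄′, t″u, v̄′, wv″)` of the (GC3) relation
(Sweedler summation implicit). -/
def gc3B (g : ℕ) (t u v w : TA g) : T4 g :=
  (TensorProduct.assoc ℚ (TA g) (TA g) (TA g ⊗[ℚ] TA g))
    ((TensorProduct.map (barT g) (LinearMap.mulRight ℚ u)) (comul g t) ⊗ₜ[ℚ]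
     (TensorProduct.map (barT g) (LinearMap.mulLeft ℚ w)) (comul g v))

/-- The third term `Θ(tu″, ū′, w″v, w̄′)` of the (GC3) relation
(Sweedler summation implicit). -/
def gc3C (g : ℕ) (t u v w : TA g) : T4 g :=
  (TensorProduct.assoc ℚ (TA g) (TA g) (TA g ⊗[ℚ] TA g))
    ((TensorProduct.comm ℚ (TA g) (TA g)
        ((TensorProduct.map (barT g) (LinearMap.mulLeft ℚ t)) (comul g u))) ⊗ₜ[ℚ]
     (TensorProduct.comm ℚ (TA g) (TA g)
        ((TensorProduct.map (barT g) (LinearMap.mulRight ℚ v)) (comul g w))))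

/-- The full (GC3) element `Θ(t,u,v,w) + Θ(t̄′,t″u,v̄′,wv″) + Θ(tu″,ū′,w″v,w̄′)`. -/
def gc3 (g : ℕ) (t u v w : TA g) : T4 g :=
  Th g t u v w + gc3B g t u v w + gc3C g t u v w

/-- The relations (CS), (HB) and (GC3) defining `Ω̃₂`. -/
def OmegaRel (g : ℕ) : Set (T4 g) :=
  {x | (∃ t u v w : TA g,
          x = Th g t u v w - Th g (barT g v) (barT g w) (barT g t) (barT g u)) ∨
       (∃ t u v w : TA g,
          x = Th g t u v w - Th g (barT g u) (barT g t) (barT g w) (barT g v)) ∨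
       (∃ (t u v w : TA g) (a : Hsp g),
          x = Th g t u v (w * TensorAlgebra.ι ℚ a)
              - Th g t u (TensorAlgebra.ι ℚ a * v) w
              - Th g t (TensorAlgebra.ι ℚ a * u) v w
              + Th g (t * TensorAlgebra.ι ℚ a) u v w) ∨
       (∃ t u v w : TA g, x = gc3 g t u v w)}

/-- The 2-loop space `Ω̃₂`. -/
abbrev Omega2 (g : ℕ) : Type := T4 g ⧸ Submodule.span ℚ (OmegaRel g)

/-- The class `Θ(t,u,v,w) ∈ Ω̃₂`. -/
def ThO (g : ℕ) (t u v w : TA g) : Omega2 g := Submodule.Quotient.mk (Th g t u v w)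

/-- The presentation space for `C_{1,2}ℋ`: one copy of `T⊗T⊗T⊗T` for the theta
generators and one for the dumbbell generators. -/
abbrev P2 (g : ℕ) : Type := T4 g × T4 g

/-- The theta generator in the presentation space. -/
def ThP (g : ℕ) (t u v w : TA g) : P2 g := (Th g t u v w, 0)

/-- The dumbbell generator in the presentation space. -/
def DP (g : ℕ) (t u v w : TA g) : P2 g := (0, Th g t u v w)

/-- The relations (CS), (HB) and (CC) defining `C₁₂ = C_{1,2}ℋ`. -/
def C12Rel (g : ℕ) : Set (P2 g) :=
  {x | (∃ t u v w : TA g,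
          x = ThP g t u v w - ThP g (barT g v) (barT g w) (barT g t) (barT g u)) ∨
       (∃ t u v w : TA g,
          x = ThP g t u v w - ThP g (barT g u) (barT g t) (barT g w) (barT g v)) ∨
       (∃ t u v w : TA g,
          x = DP g t u v w - DP g (barT g v) u (barT g t) w) ∨
       (∃ t u v w : TA g,
          x = DP g t u v w - DP g (barT g u) (barT g t) (barT g w) (barT g v)) ∨
       (∃ (t u v w : TA g) (a : Hsp g),
          x = ThP g t u v (w * TensorAlgebra.ι ℚ a)
              - ThP g t u (TensorAlgebra.ι ℚ a * v) w
              - ThP g t (TensorAlgebra.ι ℚ a * u) v w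
              + ThP g (t * TensorAlgebra.ι ℚ a) u v w) ∨
       (∃ (t u v w : TA g) (a : Hsp g),
          x = DP g t u (TensorAlgebra.ι ℚ a * v) w
              - DP g (t * TensorAlgebra.ι ℚ a) u v w
              - DP g t u v (w * TensorAlgebra.ι ℚ a)
              + DP g t (TensorAlgebra.ι ℚ a * u) v w) ∨
       (∃ t u v w : TA g,
          x = DP g t u v w - ThP g t u v w - ThP g (barT g v) u (barT g t) w)}

/-- The space `C₁₂ = C_{1,2}ℋ`. -/
abbrev C12 (g : ℕ) : Type := P2 g ⧸ Submodule.span ℚ (C12Rel g)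

/-- The class `Θ(t,u,v,w) ∈ C₁₂`. -/
def ThC (g : ℕ) (t u v w : TA g) : C12 g := Submodule.Quotient.mk (ThP g t u v w)

/-- The class `D(t,u,v,w) ∈ C₁₂`. -/
def DC (g : ℕ) (t u v w : TA g) : C12 g := Submodule.Quotient.mk (DP g t u v w)

/-- The element `GC3(t,u,v,w) ∈ C₁₂`. -/
def gc3C12 (g : ℕ) (t u v w : TA g) : C12 g :=
  Submodule.Quotient.mk ((gc3 g t u v w, 0) : P2 g)

/-- The degree-`n` component `H^{⊗n}` of the tensor algebra. -/
def TAdeg (g n : ℕ) : Submodule ℚ (TA g) :=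
  (LinearMap.range (TensorAlgebra.ι ℚ : Hsp g →ₗ[ℚ] TA g)) ^ n

/-- The part of `T⊗T⊗T⊗T` of total tensor degree `m`. -/
def T4deg (g m : ℕ) : Submodule ℚ (T4 g) :=
  Submodule.span ℚ {x | ∃ i j k l : ℕ, i + j + k + l = m ∧
    ∃ t ∈ TAdeg g i, ∃ u ∈ TAdeg g j, ∃ v ∈ TAdeg g k, ∃ w ∈ TAdeg g l,
      x = Th g t u v w}

/-- The part `Ω̃₂^{(m)}` of total tensor degree `m`. -/
def Omega2deg (g m : ℕ) : Submodule ℚ (Omega2 g) :=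
  Submodule.map (Submodule.span ℚ (OmegaRel g)).mkQ (T4deg g m)

/-- The part `C₁₂^{(m)}` of total tensor degree `m` (Lie degree `n = m + 2`). -/
def C12deg (g m : ℕ) : Submodule ℚ (C12 g) :=
  Submodule.map (Submodule.span ℚ (C12Rel g)).mkQ ((T4deg g m).prod (T4deg g m))

/-- The functorial action of a linear endomorphism of `H` on the tensor algebra. -/
def TAmap (g : ℕ) (φ : Hsp g →ₗ[ℚ] Hsp g) : TA g →ₐ[ℚ] TA g :=
  TensorAlgebra.lift ℚ (TensorAlgebra.ι ℚ ∘ₗ φ)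

/-- The diagonal action on `T⊗T⊗T⊗T`. -/
def T4map (g : ℕ) (φ : Hsp g →ₗ[ℚ] Hsp g) : T4 g →ₗ[ℚ] T4 g :=
  TensorProduct.map (TAmap g φ).toLinearMap
    (TensorProduct.map (TAmap g φ).toLinearMap
      (TensorProduct.map (TAmap g φ).toLinearMap (TAmap g φ).toLinearMap))

/-- The diagonal action on the presentation space of `C₁₂`. -/
def P2map (g : ℕ) (φ : Hsp g →ₗ[ℚ] Hsp g) : P2 g →ₗ[ℚ] P2 g :=
  (T4map g φ).prodMap (T4map g φ)

/-- The action of `GL(H)` on polynomials, realizing `MvPolynomial (Fin 2g) ℚ` as the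
symmetric algebra `Sym H` via `eᵢ ↦ Xᵢ`. -/
def polyAct (g : ℕ) (σ : Hsp g ≃ₗ[ℚ] Hsp g) :
    MvPolynomial (Fin (2 * g)) ℚ →ₐ[ℚ] MvPolynomial (Fin (2 * g)) ℚ :=
  MvPolynomial.aeval fun i => ∑ j, MvPolynomial.C (σ (Pi.single i 1) j) * MvPolynomial.X j

/-- The `m`-th symmetric power `Sym^m H`, realized as the homogeneous polynomials of
degree `m`. -/
abbrev SymP (g m : ℕ) : Type := ↥(MvPolynomial.homogeneousSubmodule (Fin (2 * g)) ℚ m)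

/-- The space of `GL(H)`-equivariant linear maps `C₁₂^{(m)} → Λ^n H`. -/
def equivC12toLam (g m n : ℕ) :
    Submodule ℚ (↥(C12deg g m) →ₗ[ℚ] ↥(⋀[ℚ]^n (Hsp g))) where
  carrier := {π | ∀ (σ : Hsp g ≃ₗ[ℚ] Hsp g) (p : P2 g)
      (hx : Submodule.Quotient.mk p ∈ C12deg g m)
      (hy : Submodule.Quotient.mk (P2map g σ.toLinearMap p) ∈ C12deg g m),
      (↑(π ⟨Submodule.Quotient.mk (P2map g σ.toLinearMap p), hy⟩) :
          ExteriorAlgebra ℚ (Hsp g))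
        = ExteriorAlgebra.map σ.toLinearMap
            ↑(π ⟨Submodule.Quotient.mk p, hx⟩)}
  add_mem' := by
    intro f₁ f₂ h₁ h₂ σ p hx hy
    simp only [LinearMap.add_apply, Submodule.coe_add, h₁ σ p hx hy, h₂ σ p hx hy, map_add]
  zero_mem' := by
    intro σ p hx hy
    simp
  smul_mem' := by
    intro c f h σ p hx hy
    simp only [LinearMap.smul_apply, SetLike.val_smul, h σ p hx hy, map_smul]

/-- The space of `GL(H)`-equivariant linear maps `Ω̃₂^{(m)} → Λ^n H`. -/
def equivOmega2toLam (g m n : ℕ) :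
    Submodule ℚ (↥(Omega2deg g m) →ₗ[ℚ] ↥(⋀[ℚ]^n (Hsp g))) where
  carrier := {π | ∀ (σ : Hsp g ≃ₗ[ℚ] Hsp g) (x : T4 g)
      (hx : Submodule.Quotient.mk x ∈ Omega2deg g m)
      (hy : Submodule.Quotient.mk (T4map g σ.toLinearMap x) ∈ Omega2deg g m),
      (↑(π ⟨Submodule.Quotient.mk (T4map g σ.toLinearMap x), hy⟩) :
          ExteriorAlgebra ℚ (Hsp g))
        = ExteriorAlgebra.map σ.toLinearMap
            ↑(π ⟨Submodule.Quotient.mk x, hx⟩)}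
  add_mem' := by
    intro f₁ f₂ h₁ h₂ σ p hx hy
    simp only [LinearMap.add_apply, Submodule.coe_add, h₁ σ p hx hy, h₂ σ p hx hy, map_add]
  zero_mem' := by
    intro σ p hx hy
    simp
  smul_mem' := by
    intro c f h σ p hx hy
    simp only [LinearMap.smul_apply, SetLike.val_smul, h σ p hx hy, map_smul]

/-- The space of `GL(H)`-equivariant linear maps `C₁₂^{(m)} → Sym^n H`. -/
def equivC12toSym (g m n : ℕ) :
    Submodule ℚ (↥(C12deg g m) →ₗ[ℚ] SymP g n) where
  carrier := {π | ∀ (σ : Hsp g ≃ₗ[ℚ] Hsp g) (p : P2 g)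
      (hx : Submodule.Quotient.mk p ∈ C12deg g m)
      (hy : Submodule.Quotient.mk (P2map g σ.toLinearMap p) ∈ C12deg g m),
      (↑(π ⟨Submodule.Quotient.mk (P2map g σ.toLinearMap p), hy⟩) :
          MvPolynomial (Fin (2 * g)) ℚ)
        = polyAct g σ ↑(π ⟨Submodule.Quotient.mk p, hx⟩)}
  add_mem' := by
    intro f₁ f₂ h₁ h₂ σ p hx hy
    simp only [LinearMap.add_apply, Submodule.coe_add, h₁ σ p hx hy, h₂ σ p hx hy, map_add]
  zero_mem' := by
    intro σ p hx hy
    simp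
  smul_mem' := by
    intro c f h σ p hx hy
    simp only [LinearMap.smul_apply, SetLike.val_smul, h σ p hx hy, map_smul]

/-- The space of `GL(H)`-equivariant linear maps `Ω̃₂^{(m)} → Sym^n H`. -/
def equivOmega2toSym (g m n : ℕ) :
    Submodule ℚ (↥(Omega2deg g m) →ₗ[ℚ] SymP g n) where
  carrier := {π | ∀ (σ : Hsp g ≃ₗ[ℚ] Hsp g) (x : T4 g)
      (hx : Submodule.Quotient.mk x ∈ Omega2deg g m)
      (hy : Submodule.Quotient.mk (T4map g σ.toLinearMap x) ∈ Omega2deg g m),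
      (↑(π ⟨Submodule.Quotient.mk (T4map g σ.toLinearMap x), hy⟩) :
          MvPolynomial (Fin (2 * g)) ℚ)
        = polyAct g σ ↑(π ⟨Submodule.Quotient.mk x, hx⟩)}
  add_mem' := by
    intro f₁ f₂ h₁ h₂ σ p hx hy
    simp only [LinearMap.add_apply, Submodule.coe_add, h₁ σ p hx hy, h₂ σ p hx hy, map_add]
  zero_mem' := by
    intro σ p hx hy
    simp
  smul_mem' := by
    intro c f h σ p hx hy
    simp only [LinearMap.smul_apply, SetLike.val_smul, h σ p hx hy, map_smul]

/-- The space of `GL(H)`-equivariant linear maps `C₁₂^{(4)} → Λ⁴H` which kill all the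
(GC3) elements of total tensor degree `4`, i.e. those that factor through
`Ω̃₂^{(4)} = C₁₂^{(4)}/span{GC3}`. -/
def equivC12toLamGC3 (g : ℕ) : Submodule ℚ (↥(C12deg g 4) →ₗ[ℚ] ↥(⋀[ℚ]^4 (Hsp g))) :=
  equivC12toLam g 4 4 ⊓
    { carrier := {π | ∀ (i j k l : ℕ), i + j + k + l = 4 →
        ∀ t ∈ TAdeg g i, ∀ u ∈ TAdeg g j, ∀ v ∈ TAdeg g k, ∀ w ∈ TAdeg g l,
        ∀ h : gc3C12 g t u v w ∈ C12deg g 4,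
          π ⟨gc3C12 g t u v w, h⟩ = 0}
      add_mem' := by
        intro f₁ f₂ h₁ h₂ i j k l hijkl t ht u hu v hv w hw h
        simp only [LinearMap.add_apply, h₁ i j k l hijkl t ht u hu v hv w hw h,
          h₂ i j k l hijkl t ht u hu v hv w hw h, add_zero]
      zero_mem' := by intro i j k l hijkl t ht u hu v hv w hw h; simp
      smul_mem' := by
        intro c f hf i j k l hijkl t ht u hu v hv w hw h
        simp only [LinearMap.smul_apply, hf i j k l hijkl t ht u hu v hv w hw h, smul_zero] }

namespace LambdaFour

variable {g : ℕ}

/-! ### Words in the tensor algebra and their exterior products -/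

/-- The product in the tensor algebra of a list of vectors. -/
def word (L : List (Hsp g)) : TA g := (L.map (TensorAlgebra.ι ℚ)).prod

/-- The exterior product of a list of vectors. -/
def wedge (L : List (Hsp g)) : ExteriorAlgebra ℚ (Hsp g) := (L.map (ExteriorAlgebra.ι ℚ)).prod

@[simp] lemma word_nil : word ([] : List (Hsp g)) = 1 := rfl

@[simp] lemma word_cons (a : Hsp g) (L : List (Hsp g)) :
    word (a :: L) = TensorAlgebra.ι ℚ a * word L := by simp [word]

lemma word_append (L M : List (Hsp g)) : word (L ++ M) = word L * word M := by simp [word]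

@[simp] lemma wedge_nil : wedge ([] : List (Hsp g)) = 1 := rfl

@[simp] lemma wedge_cons (a : Hsp g) (L : List (Hsp g)) :
    wedge (a :: L) = ExteriorAlgebra.ι ℚ a * wedge L := by simp [wedge]

lemma wedge_append (L M : List (Hsp g)) : wedge (L ++ M) = wedge L * wedge M := by simp [wedge]

lemma toExterior_word (L : List (Hsp g)) : TensorAlgebra.toExterior (word L) = wedge L := by
  induction L with
  | nil => simp
  | cons a L ih => simp [ih]

lemma word_mem_TAdeg (L : List (Hsp g)) : word L ∈ TAdeg g L.length := by
  induction L with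
  | nil => simp [TAdeg, Submodule.one_eq_range, Algebra.linearMap_apply]
  | cons a L ih =>
    rw [word_cons, List.length_cons, TAdeg, pow_succ']
    exact Submodule.mul_mem_mul (LinearMap.mem_range_self _ a) ih

lemma wedge_mem (L : List (Hsp g)) : wedge L ∈ ⋀[ℚ]^L.length (Hsp g) := by
  induction L with
  | nil => simp [Submodule.one_eq_range, Algebra.linearMap_apply]
  | cons a L ih =>
    rw [wedge_cons, List.length_cons, ExteriorAlgebra.exteriorPower, pow_succ']
    exact Submodule.mul_mem_mul (LinearMap.mem_range_self _ a) ih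

lemma TAmap_word (φ : Hsp g →ₗ[ℚ] Hsp g) (L : List (Hsp g)) :
    TAmap g φ (word L) = word (L.map φ) := by
  induction L with
  | nil => simp
  | cons a L ih => simp [ih]; simp [TAmap]

lemma map_wedge (φ : Hsp g →ₗ[ℚ] Hsp g) (L : List (Hsp g)) :
    ExteriorAlgebra.map φ (wedge L) = wedge (L.map φ) := by
  induction L with
  | nil => simp
  | cons a L ih => simp [ih]

/-- The list of standard basis vectors with the given indices. -/
def vecs (A : List (Fin (2 * g))) : List (Hsp g) := A.map fun i => Pi.single i 1

@[simp] lemma length_vecs (A : List (Fin (2 * g))) : (vecs A).length = A.length := by simp [vecs]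

/-- Words in basis vectors of length `n` span the degree `n` part of the tensor algebra. -/
lemma TAdeg_le_span (n : ℕ) :
    TAdeg g n ≤ Submodule.span ℚ
      {x | ∃ L : List (Fin (2 * g)), L.length = n ∧
        x = word (vecs L)} := by
  induction n with
  | zero =>
    rw [TAdeg, pow_zero, Submodule.one_eq_span]
    exact Submodule.span_mono (by rintro _ rfl; exact ⟨[], rfl, rfl⟩)
  | succ n ih =>
    have h1 : LinearMap.range (TensorAlgebra.ι ℚ : Hsp g →ₗ[ℚ] TA g) ≤
        Submodule.span ℚ (Set.range fun i : Fin (2 * g) =>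
          TensorAlgebra.ι ℚ (Pi.single i 1 : Hsp g)) := by
      rintro _ ⟨a, rfl⟩
      rw [pi_eq_sum_univ' a, map_sum]
      refine Submodule.sum_mem _ fun i _ => ?_
      rw [map_smul]
      refine Submodule.smul_mem _ _ (Submodule.subset_span ⟨i, ?_⟩)
      congr 1
    rw [TAdeg, pow_succ']
    refine (mul_le_mul' h1 ih).trans ?_
    rw [Submodule.span_mul_span]
    refine Submodule.span_mono ?_
    rintro _ ⟨_, ⟨i, rfl⟩, _, ⟨L, rfl, rfl⟩, rfl⟩
    exact ⟨i :: L, rfl, by simp [vecs]⟩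

lemma span_words : Submodule.span ℚ (Set.range (word (g := g))) = ⊤ := by
  rw [eq_top_iff]
  rintro x -
  induction x using TensorAlgebra.induction with
  | algebraMap r =>
    rw [Algebra.algebraMap_eq_smul_one]
    exact Submodule.smul_mem _ _ (Submodule.subset_span ⟨[], rfl⟩)
  | ι a => exact Submodule.subset_span ⟨[a], by simp⟩
  | mul a b ha hb =>
    have := Submodule.mul_mem_mul ha hb
    rw [Submodule.span_mul_span] at this
    refine Submodule.span_mono ?_ this
    rintro _ ⟨_, ⟨L, rfl⟩, _, ⟨M, rfl⟩, rfl⟩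
    exact ⟨L ++ M, word_append L M⟩
  | add a b ha hb => exact Submodule.add_mem _ ha hb

/-! ### Signs -/

/-- The sign by which the antipode acts on the `n`-th exterior power. -/
def barSign : ℕ → ℚ
  | 0 => 1
  | n + 1 => (-1) ^ (n + 1) * barSign n

lemma ι_mul_wedge (a : Hsp g) (L : List (Hsp g)) :
    ExteriorAlgebra.ι ℚ a * wedge L =
      ((-1 : ℚ) ^ L.length) • (wedge L * ExteriorAlgebra.ι ℚ a) := by
  induction L with
  | nil => simp
  | cons b L ih =>
    have h : ExteriorAlgebra.ι ℚ a * ExteriorAlgebra.ι ℚ b =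
        -(ExteriorAlgebra.ι ℚ b * ExteriorAlgebra.ι ℚ a) :=
      eq_neg_of_add_eq_zero_left (ExteriorAlgebra.ι_add_mul_swap a b)
    rw [wedge_cons, ← mul_assoc, h, neg_mul, mul_assoc, ih, List.length_cons, pow_succ]
    simp [mul_assoc]

lemma wedge_mul_comm (L M : List (Hsp g)) :
    wedge L * wedge M = ((-1 : ℚ) ^ (L.length * M.length)) • (wedge M * wedge L) := by
  induction L with
  | nil => simp
  | cons a L ih =>
    rw [wedge_cons, mul_assoc, ih, mul_smul_comm, ← mul_assoc, ι_mul_wedge, smul_mul_assoc,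
      smul_smul, mul_assoc, List.length_cons, ← pow_add]
    congr 2
    ring

lemma barT_one : barT g 1 = 1 := by simp [barT]

lemma barT_ι_mul (a : Hsp g) (x : TA g) :
    barT g (TensorAlgebra.ι ℚ a * x) = -(barT g x * TensorAlgebra.ι ℚ a) := by
  simp [barT]

lemma barT_word (L : List (Hsp g)) :
    barT g (word L) = ((-1 : ℚ) ^ L.length) • word L.reverse := by
  induction L with
  | nil => simp [barT_one]
  | cons a L ih =>
    rw [word_cons, barT_ι_mul, ih, List.reverse_cons, word_append, List.length_cons, pow_succ]
    simp

lemma wedge_reverse (L : List (Hsp g)) :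
    ((-1 : ℚ) ^ L.length) • wedge L.reverse = barSign L.length • wedge L := by
  induction L with
  | nil => simp [barSign]
  | cons a L ih =>
    have h : wedge L.reverse * ExteriorAlgebra.ι ℚ a =
        ((-1 : ℚ) ^ L.length) • (ExteriorAlgebra.ι ℚ a * wedge L.reverse) := by
      rw [ι_mul_wedge, List.length_reverse, smul_smul, ← mul_pow]
      simp
    rw [List.reverse_cons, wedge_append, wedge_cons, wedge_nil, mul_one, h, wedge_cons,
      ← mul_smul_comm, ih, List.length_cons, barSign, mul_smul_comm, smul_smul]

/-! ### The linear maps attached to a coefficient function -/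

/-- The degree `i` part of the exterior product. -/
def extPart (g i : ℕ) : TA g →ₗ[ℚ] ExteriorAlgebra ℚ (Hsp g) :=
  GradedAlgebra.proj (fun i : ℕ => ⋀[ℚ]^i (Hsp g)) i ∘ₗ TensorAlgebra.toExterior.toLinearMap

lemma extPart_mem (i : ℕ) (t : TA g) : extPart g i t ∈ ⋀[ℚ]^i (Hsp g) := by
  simp [extPart, GradedAlgebra.proj_apply]

lemma extPart_word (i : ℕ) (L : List (Hsp g)) :
    extPart g i (word L) = if i = L.length then wedge L else 0 := by
  simp only [extPart, LinearMap.comp_apply, AlgHom.toLinearMap_apply, toExterior_word,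
    GradedAlgebra.proj_apply]
  split_ifs with h
  · subst h
    exact DirectSum.decompose_of_mem_same _ (wedge_mem L)
  · exact DirectSum.decompose_of_mem_ne _ (wedge_mem L) (Ne.symm h)

/-- A function of four degrees. -/
abbrev Coef : Type := ℕ → ℕ → ℕ → ℕ → ℚ

/-- The quadruples of degrees with sum `m`. -/
def quads (m : ℕ) : Finset (ℕ × ℕ × ℕ × ℕ) :=
  (Finset.range (m + 1) ×ˢ Finset.range (m + 1) ×ˢ Finset.range (m + 1) ×ˢ
    Finset.range (m + 1)).filter fun x => x.1 + x.2.1 + x.2.2.1 + x.2.2.2 = m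

lemma mem_quads {m i j k l : ℕ} : (i, j, k, l) ∈ quads m ↔ i + j + k + l = m := by
  simp only [quads, Finset.mem_filter, Finset.mem_product, Finset.mem_range]
  omega

/-- The product of the exterior parts of degrees `i`, `j`, `k`, `l` of the four slots. -/
def wedgePart (g i j k l : ℕ) : T4 g →ₗ[ℚ] ExteriorAlgebra ℚ (Hsp g) :=
  LinearMap.mul' ℚ _ ∘ₗ TensorProduct.map (extPart g i)
    (LinearMap.mul' ℚ _ ∘ₗ TensorProduct.map (extPart g j)
      (LinearMap.mul' ℚ _ ∘ₗ TensorProduct.map (extPart g k) (extPart g l)))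

/-- The map `T⊗T⊗T⊗T → ΛH` given in degree `(i,j,k,l)`, with `i+j+k+l = 4`, by the coefficient
`c i j k l` times the exterior product. -/
def wedgeMap (g : ℕ) (c : Coef) : T4 g →ₗ[ℚ] ExteriorAlgebra ℚ (Hsp g) :=
  ∑ x ∈ quads 4, c x.1 x.2.1 x.2.2.1 x.2.2.2 • wedgePart g x.1 x.2.1 x.2.2.1 x.2.2.2

/-- Coefficient functions concentrated in total degree `4`. -/
def Supp (c : Coef) : Prop := ∀ i j k l, i + j + k + l ≠ 4 → c i j k l = 0

/-- The exterior product of `t` is homogeneous of degree `n` and equal to `X`. -/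
def HasWedge (t : TA g) (n : ℕ) (X : ExteriorAlgebra ℚ (Hsp g)) : Prop :=
  ∀ i, extPart g i t = if i = n then X else 0

lemma hasWedge_word (L : List (Hsp g)) : HasWedge (word L) L.length (wedge L) :=
  fun i => extPart_word i L

lemma hasWedge_word_mul_word (L M : List (Hsp g)) :
    HasWedge (word L * word M) (L.length + M.length) (wedge L * wedge M) := by
  rw [← word_append, ← wedge_append, ← List.length_append]
  exact hasWedge_word _

lemma hasWedge_ι_mul_word (a : Hsp g) (L : List (Hsp g)) :
    HasWedge (TensorAlgebra.ι ℚ a * word L) (L.length + 1) (ExteriorAlgebra.ι ℚ a * wedge L) := by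
  rw [← word_cons, ← wedge_cons, ← List.length_cons]
  exact hasWedge_word _

lemma hasWedge_word_mul_ι (a : Hsp g) (L : List (Hsp g)) :
    HasWedge (word L * TensorAlgebra.ι ℚ a) (L.length + 1) (wedge L * ExteriorAlgebra.ι ℚ a) := by
  simpa using hasWedge_word_mul_word L [a]

lemma hasWedge_barT_word (L : List (Hsp g)) :
    HasWedge (barT g (word L)) L.length (barSign L.length • wedge L) := by
  intro i
  rw [barT_word, map_smul, extPart_word, List.length_reverse, smul_ite, smul_zero, wedge_reverse]

lemma wedgeMap_apply {c : Coef} (hc : Supp c) {t u v w : TA g} {i j k l : ℕ}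
    {X Y Z W : ExteriorAlgebra ℚ (Hsp g)} (ht : HasWedge t i X) (hu : HasWedge u j Y)
    (hv : HasWedge v k Z) (hw : HasWedge w l W) :
    wedgeMap g c (Th g t u v w) = c i j k l • (X * Y * Z * W) := by
  have key : ∀ i' j' k' l', wedgePart g i' j' k' l' (Th g t u v w) =
      if (i', j', k', l') = (i, j, k, l) then X * Y * Z * W else 0 := by
    intro i' j' k' l'
    simp only [wedgePart, Th, LinearMap.comp_apply, TensorProduct.map_tmul, LinearMap.mul'_apply,
      ht i', hu j', hv k', hw l', Prod.mk.injEq]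
    split_ifs <;> simp_all [mul_assoc]
  simp only [wedgeMap, LinearMap.sum_apply, LinearMap.smul_apply, key]
  by_cases h : i + j + k + l = 4
  · rw [Finset.sum_eq_single_of_mem _ (mem_quads.2 h)]
    · simp
    · rintro ⟨i', j', k', l'⟩ - hne
      simp only [if_neg hne, smul_zero]
  · rw [hc _ _ _ _ h, zero_smul]
    refine Finset.sum_eq_zero ?_
    rintro ⟨i', j', k', l'⟩ hx
    rw [if_neg, smul_zero]
    rintro hx'
    rw [hx', mem_quads] at hx
    exact h hx

lemma wedgeMap_mem (c : Coef) (x : T4 g) : wedgeMap g c x ∈ ⋀[ℚ]^4 (Hsp g) := by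
  have key : ∀ i j k l, i + j + k + l = 4 → wedgePart g i j k l x ∈ ⋀[ℚ]^4 (Hsp g) := by
    intro i j k l h
    induction x using TensorProduct.induction_on with
    | zero => simp
    | add x y hx hy => rw [map_add]; exact Submodule.add_mem _ hx hy
    | tmul t x =>
      induction x using TensorProduct.induction_on with
      | zero => simp
      | add x y hx hy => rw [tmul_add, map_add]; exact Submodule.add_mem _ hx hy
      | tmul u x =>
        induction x using TensorProduct.induction_on with
        | zero => simp
        | add x y hx hy => rw [tmul_add, tmul_add, map_add]; exact Submodule.add_mem _ hx hy
        | tmul v w =>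
          simp only [wedgePart, LinearMap.comp_apply, TensorProduct.map_tmul, LinearMap.mul'_apply]
          rw [← h, add_assoc, add_assoc]
          exact SetLike.mul_mem_graded (extPart_mem i t) (SetLike.mul_mem_graded (extPart_mem j u)
            (SetLike.mul_mem_graded (extPart_mem k v) (extPart_mem l w)))
  rw [wedgeMap, LinearMap.sum_apply]
  refine Submodule.sum_mem _ ?_
  rintro ⟨i, j, k, l⟩ hx
  exact Submodule.smul_mem _ _ (key i j k l (mem_quads.1 hx))

lemma wedgeMap_add (c d : Coef) :
    wedgeMap g (fun i j k l => c i j k l + d i j k l) = wedgeMap g c + wedgeMap g d := by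
  simp [wedgeMap, add_smul, Finset.sum_add_distrib]

lemma wedgeMap_smul (r : ℚ) (c : Coef) :
    wedgeMap g (fun i j k l => r * c i j k l) = r • wedgeMap g c := by
  simp [wedgeMap, mul_smul, Finset.smul_sum]

/-- A multilinear function of four tensors vanishes if it does so on words. -/
lemma eq_zero_of_words {M : Type*} [AddCommGroup M] [Module ℚ M]
    (X : TA g → TA g → TA g → TA g → M)
    (h₁ : ∀ u v w, IsLinearMap ℚ fun t => X t u v w)
    (h₂ : ∀ t v w, IsLinearMap ℚ fun u => X t u v w)
    (h₃ : ∀ t u w, IsLinearMap ℚ fun v => X t u v w)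
    (h₄ : ∀ t u v, IsLinearMap ℚ fun w => X t u v w)
    (h : ∀ A B C D, X (word A) (word B) (word C) (word D) = 0) (t u v w : TA g) :
    X t u v w = 0 := by
  have key : ∀ f : TA g → M, IsLinearMap ℚ f → (∀ A, f (word A) = 0) → ∀ t, f t = 0 := by
    intro f hf h0 t
    have : hf.mk' f = 0 := LinearMap.ext_on_range span_words (by simpa using h0)
    exact LinearMap.congr_fun this t
  refine key _ (h₁ u v w) (fun A => ?_) t
  refine key _ (h₂ _ v w) (fun B => ?_) u
  refine key _ (h₃ _ _ w) (fun C => ?_) v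
  exact key _ (h₄ _ _ _) (fun D => h A B C D) w

end LambdaFour

namespace LambdaFour

variable {g : ℕ}

/-! ### The relations in terms of coefficient functions -/

/-- The exterior product of four words. -/
def wedge4 (A B C D : List (Hsp g)) : ExteriorAlgebra ℚ (Hsp g) :=
  wedge A * wedge B * wedge C * wedge D

/-- The first symmetry (CS) for theta coefficients. -/
def csSwap (c : Coef) : Coef := fun i j k l =>
  c i j k l - barSign i * barSign j * barSign k * barSign l * (-1) ^ ((i + j) * (k + l)) * c k l i j

/-- The second symmetry (CS), common to theta and dumbbell coefficients. -/
def csFlip (c : Coef) : Coef := fun i j k l =>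
  c i j k l - barSign i * barSign j * barSign k * barSign l * (-1) ^ (i * j + k * l) * c j i l k

/-- The coefficient function of `(t,u,v,w) ↦ Θ(v̄,u,t̄,w)`. -/
def crossing (c : Coef) : Coef := fun i j k l =>
  barSign i * barSign k * (-1) ^ (k * (i + j) + i * j) * c k j i l

/-- The relation (HB) for coefficients. -/
def hairBalance (c : Coef) : Coef := fun i j k l =>
  c i j k (l + 1) - (-1) ^ (k + l) * c i j (k + 1) l - (-1) ^ (j + k + l) * c i (j + 1) k l
    + (-1) ^ (j + k + l) * c (i + 1) j k l

lemma wedge4_swap (A B C D : List (Hsp g)) : wedge4 C D A B =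
    ((-1 : ℚ) ^ ((A.length + B.length) * (C.length + D.length))) • wedge4 A B C D := by
  have := wedge_mul_comm (C ++ D) (A ++ B)
  simp only [wedge_append, List.length_append, ← mul_assoc] at this
  rw [wedge4, this, wedge4, mul_comm (C.length + _)]

lemma wedge4_flip (A B C D : List (Hsp g)) : wedge4 B A D C =
    ((-1 : ℚ) ^ (A.length * B.length + C.length * D.length)) • wedge4 A B C D := by
  rw [wedge4, wedge4, mul_assoc, wedge_mul_comm B A, wedge_mul_comm D C, smul_mul_smul_comm,
    ← pow_add, mul_assoc (wedge A * wedge B), mul_comm B.length, mul_comm D.length]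

lemma wedge4_cross (A B C D : List (Hsp g)) : wedge4 C B A D =
    ((-1 : ℚ) ^ (C.length * (A.length + B.length) + A.length * B.length)) • wedge4 A B C D := by
  have h := wedge_mul_comm C (B ++ A)
  simp only [wedge_append, List.length_append, ← mul_assoc] at h
  rw [wedge4, wedge4, h, wedge_mul_comm B A, smul_mul_assoc, smul_mul_assoc, smul_mul_assoc,
    smul_smul, ← pow_add, add_comm B.length, mul_comm B.length]

lemma wedgeMap_word {c : Coef} (hc : Supp c) (A B C D : List (Hsp g)) :
    wedgeMap g c (Th g (word A) (word B) (word C) (word D)) =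
      c A.length B.length C.length D.length • wedge4 A B C D :=
  wedgeMap_apply hc (hasWedge_word A) (hasWedge_word B) (hasWedge_word C) (hasWedge_word D)

lemma wedgeMap_csSwap {c : Coef} (hc : Supp c) (A B C D : List (Hsp g)) :
    wedgeMap g c (Th g (word A) (word B) (word C) (word D)
      - Th g (barT g (word C)) (barT g (word D)) (barT g (word A)) (barT g (word B))) =
      csSwap c A.length B.length C.length D.length • wedge4 A B C D := by
  rw [map_sub, wedgeMap_word hc, wedgeMap_apply hc (hasWedge_barT_word C) (hasWedge_barT_word D)
    (hasWedge_barT_word A) (hasWedge_barT_word B), csSwap, sub_smul]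
  simp only [smul_mul_smul_comm, smul_smul]
  rw [← wedge4, wedge4_swap A B C D, smul_smul]
  congr 2
  ring

lemma wedgeMap_csFlip {c : Coef} (hc : Supp c) (A B C D : List (Hsp g)) :
    wedgeMap g c (Th g (word A) (word B) (word C) (word D)
      - Th g (barT g (word B)) (barT g (word A)) (barT g (word D)) (barT g (word C))) =
      csFlip c A.length B.length C.length D.length • wedge4 A B C D := by
  rw [map_sub, wedgeMap_word hc, wedgeMap_apply hc (hasWedge_barT_word B) (hasWedge_barT_word A)
    (hasWedge_barT_word D) (hasWedge_barT_word C), csFlip, sub_smul]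
  simp only [smul_mul_smul_comm, smul_smul]
  rw [← wedge4, wedge4_flip A B C D, smul_smul]
  congr 2
  ring

lemma wedgeMap_crossing {c : Coef} (hc : Supp c) (A B C D : List (Hsp g)) :
    wedgeMap g c (Th g (barT g (word C)) (word B) (barT g (word A)) (word D)) =
      crossing c A.length B.length C.length D.length • wedge4 A B C D := by
  rw [wedgeMap_apply hc (hasWedge_barT_word C) (hasWedge_word B)
    (hasWedge_barT_word A) (hasWedge_word D), crossing]
  simp only [smul_mul_assoc, mul_smul_comm, smul_smul]
  rw [← wedge4, wedge4_cross A B C D, smul_smul]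
  congr 1
  ring

lemma wedgeMap_hairBalance {c : Coef} (hc : Supp c) (A B C D : List (Hsp g)) (a : Hsp g) :
    wedgeMap g c (Th g (word A) (word B) (word C) (word D * TensorAlgebra.ι ℚ a)
      - Th g (word A) (word B) (TensorAlgebra.ι ℚ a * word C) (word D)
      - Th g (word A) (TensorAlgebra.ι ℚ a * word B) (word C) (word D)
      + Th g (word A * TensorAlgebra.ι ℚ a) (word B) (word C) (word D)) =
      hairBalance c A.length B.length C.length D.length • wedge4 A B C (D ++ [a]) := by
  have h1 := ι_mul_wedge a (C ++ D)
  have h2 := ι_mul_wedge a (B ++ (C ++ D))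
  simp only [wedge_append, List.length_append] at h1 h2
  have e2 : wedge A * wedge B * (ExteriorAlgebra.ι ℚ a * wedge C) * wedge D =
      (-1 : ℚ) ^ (C.length + D.length) • wedge4 A B C (D ++ [a]) := by
    rw [mul_assoc, mul_assoc (ExteriorAlgebra.ι ℚ a), h1, wedge4, mul_smul_comm]
    simp [wedge_append, mul_assoc]
  have e3 : wedge A * (ExteriorAlgebra.ι ℚ a * wedge B) * wedge C * wedge D =
      (-1 : ℚ) ^ (B.length + C.length + D.length) • wedge4 A B C (D ++ [a]) := by
    rw [mul_assoc, mul_assoc, mul_assoc (ExteriorAlgebra.ι ℚ a), h2, wedge4, mul_smul_comm]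
    simp [wedge_append, mul_assoc, add_assoc]
  have e4 : wedge A * ExteriorAlgebra.ι ℚ a * wedge B * wedge C * wedge D =
      (-1 : ℚ) ^ (B.length + C.length + D.length) • wedge4 A B C (D ++ [a]) := by
    rw [← e3]
    simp only [mul_assoc]
  have e1 : wedge A * wedge B * wedge C * (wedge D * ExteriorAlgebra.ι ℚ a) =
      wedge4 A B C (D ++ [a]) := by
    simp [wedge4, wedge_append]
  rw [map_add, map_sub, map_sub,
    wedgeMap_apply hc (hasWedge_word A) (hasWedge_word B) (hasWedge_word C)
      (hasWedge_word_mul_ι a D),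
    wedgeMap_apply hc (hasWedge_word A) (hasWedge_word B) (hasWedge_ι_mul_word a C)
      (hasWedge_word D),
    wedgeMap_apply hc (hasWedge_word A) (hasWedge_ι_mul_word a B) (hasWedge_word C)
      (hasWedge_word D),
    wedgeMap_apply hc (hasWedge_word_mul_ι a A) (hasWedge_word B) (hasWedge_word C)
      (hasWedge_word D), e1, e2, e3, e4, hairBalance]
  module

/-! ### Unshuffles and the relation (GC3) -/

/-- All ways of distributing the entries of a list over two lists, preserving the order. -/
def unshuffles {α : Type*} : List α → List (List α × List α)
  | [] => [([], [])]
  | a :: L => (unshuffles L).map (fun p => (a :: p.1, p.2)) ++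
      (unshuffles L).map (fun p => (p.1, a :: p.2))

lemma length_of_mem_unshuffles {α : Type*} (L : List α) :
    ∀ p ∈ unshuffles L, p.1.length + p.2.length = L.length := by
  induction L with
  | nil => simp [unshuffles]
  | cons a L ih =>
    intro p hp
    simp only [unshuffles, List.mem_append, List.mem_map] at hp
    rcases hp with ⟨q, hq, rfl⟩ | ⟨q, hq, rfl⟩ <;> have := ih q hq <;>
      simp only [List.length_cons] <;> omega

lemma comul_word (L : List (Hsp g)) :
    comul g (word L) = ((unshuffles L).map fun p => word p.1 ⊗ₜ[ℚ] word p.2).sum := by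
  induction L with
  | nil => simp [comul, unshuffles, Algebra.TensorProduct.one_def]
  | cons a L ih =>
    have h : comul g (TensorAlgebra.ι ℚ a * word L) =
        (TensorAlgebra.ι ℚ a ⊗ₜ[ℚ] 1 + 1 ⊗ₜ[ℚ] TensorAlgebra.ι ℚ a) * comul g (word L) := by
      simp [comul]
    rw [word_cons, h, ih, add_mul, ← List.sum_map_mul_left, ← List.sum_map_mul_left, unshuffles,
      List.map_append, List.sum_append, List.map_map, List.map_map]
    simp [Function.comp_def]

/-- The signed count of unshuffles of `n` letters, weighted by a function of the two lengths. -/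
def unshuffleSum : ℕ → (ℕ → ℕ → ℚ) → ℚ
  | 0, φ => φ 0 0
  | n + 1, φ => unshuffleSum n (fun p q => φ (p + 1) q) +
      unshuffleSum n (fun p q => (-1) ^ p * φ p (q + 1))

lemma sum_unshuffles (L : List (Hsp g)) (φ : ℕ → ℕ → ℚ)
    (f : ExteriorAlgebra ℚ (Hsp g) →ₗ[ℚ] ExteriorAlgebra ℚ (Hsp g)) :
    ((unshuffles L).map fun p =>
      φ p.1.length p.2.length • f (wedge p.1 * wedge p.2)).sum =
      unshuffleSum L.length φ • f (wedge L) := by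
  induction L generalizing φ f with
  | nil => simp [unshuffles, unshuffleSum]
  | cons a L ih =>
    have h1 := ih (fun p q => φ (p + 1) q) (f ∘ₗ LinearMap.mulLeft ℚ (ExteriorAlgebra.ι ℚ a))
    have h2 := ih (fun p q => (-1) ^ p * φ p (q + 1))
      (f ∘ₗ LinearMap.mulLeft ℚ (ExteriorAlgebra.ι ℚ a))
    rw [unshuffles, List.map_append, List.sum_append, List.map_map, List.map_map,
      List.length_cons, unshuffleSum, add_smul, wedge_cons]
    simp only [LinearMap.comp_apply, LinearMap.mulLeft_apply] at h1 h2
    rw [← h1, ← h2]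
    congr 2
    · simp [Function.comp_def, mul_assoc]
    · refine List.map_congr_left fun p _ => ?_
      have h := ι_mul_wedge a p.1
      simp only [Function.comp_apply, wedge_cons, List.length_cons]
      rw [← mul_assoc, ← mul_assoc (ExteriorAlgebra.ι ℚ a), h, smul_mul_assoc, map_smul, smul_smul,
        mul_assoc, mul_right_comm, ← mul_pow]
      simp

end LambdaFour

namespace LambdaFour

variable {g : ℕ}

lemma list_sum_tmul_list_sum {M N : Type*} [AddCommGroup M] [Module ℚ M] [AddCommGroup N]
    [Module ℚ N] (l : List M) (m : List N) :
    l.sum ⊗ₜ[ℚ] m.sum = (l.map fun x => (m.map fun y => x ⊗ₜ[ℚ] y).sum).sum := by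
  induction l with
  | nil => simp
  | cons a l ih =>
    have h : a ⊗ₜ[ℚ] m.sum = (m.map fun y => a ⊗ₜ[ℚ] y).sum :=
      map_list_sum (TensorProduct.mk ℚ M N a) m
    rw [List.sum_cons, add_tmul, ih, List.map_cons, List.sum_cons, h]

lemma gc3B_word (A B C D : List (Hsp g)) :
    gc3B g (word A) (word B) (word C) (word D) =
      ((unshuffles A).map fun p => ((unshuffles C).map fun r =>
        Th g (barT g (word p.1)) (word p.2 * word B) (barT g (word r.1))
          (word D * word r.2)).sum).sum := by
  simp only [gc3B, comul_word, map_list_sum, List.map_map, list_sum_tmul_list_sum,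
    Function.comp_def, TensorProduct.map_tmul, LinearMap.mulRight_apply, LinearMap.mulLeft_apply,
    TensorProduct.assoc_tmul, Th]

lemma gc3C_word (A B C D : List (Hsp g)) :
    gc3C g (word A) (word B) (word C) (word D) =
      ((unshuffles B).map fun p => ((unshuffles D).map fun r =>
        Th g (word A * word p.2) (barT g (word p.1)) (word r.2 * word C)
          (barT g (word r.1))).sum).sum := by
  simp only [gc3C, comul_word, map_list_sum, List.map_map, list_sum_tmul_list_sum,
    Function.comp_def, TensorProduct.map_tmul, LinearMap.mulRight_apply, LinearMap.mulLeft_apply,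
    TensorProduct.assoc_tmul, TensorProduct.comm_tmul, Th]

/-- The relation (GC3) for coefficients. -/
def gcThree (c : Coef) : Coef := fun i j k l =>
  c i j k l
    + unshuffleSum i (fun p q => unshuffleSum k fun r s =>
        barSign p * barSign r * (-1) ^ (l * s) * c p (q + j) r (l + s))
    + unshuffleSum j (fun p q => unshuffleSum l fun r s =>
        barSign p * barSign r * (-1) ^ (p * q + s * (k + r)) * c (i + q) p (s + k) r)

lemma wedgeMap_gc3B {c : Coef} (hc : Supp c) (A B C D : List (Hsp g)) :
    wedgeMap g c (gc3B g (word A) (word B) (word C) (word D)) =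
      unshuffleSum A.length (fun p q => unshuffleSum C.length fun r s =>
        barSign p * barSign r * (-1) ^ (D.length * s) * c p (q + B.length) r (D.length + s))
          • wedge4 A B C D := by
  rw [gc3B_word, map_list_sum, List.map_map]
  have houter := sum_unshuffles A (fun p q => unshuffleSum C.length fun r s =>
        barSign p * barSign r * (-1) ^ (D.length * s) * c p (q + B.length) r (D.length + s))
    (LinearMap.mulRight ℚ (wedge B * wedge C * wedge D))
  simp only [LinearMap.mulRight_apply] at houter
  rw [wedge4, mul_assoc, mul_assoc, ← mul_assoc (wedge B), ← houter]
  congr 1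
  refine List.map_congr_left fun p _ => ?_
  have hinner := sum_unshuffles C (fun r s => barSign p.1.length * barSign r *
      (-1) ^ (D.length * s) * c p.1.length (p.2.length + B.length) r (D.length + s))
    (LinearMap.mulLeft ℚ (wedge p.1 * wedge p.2 * wedge B) ∘ₗ LinearMap.mulRight ℚ (wedge D))
  simp only [LinearMap.comp_apply, LinearMap.mulRight_apply, LinearMap.mulLeft_apply] at hinner
  have e : wedge p.1 * wedge p.2 * (wedge B * wedge C * wedge D) =
      wedge p.1 * wedge p.2 * wedge B * (wedge C * wedge D) := by simp only [mul_assoc]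
  rw [e, ← hinner, Function.comp_apply, map_list_sum, List.map_map]
  congr 1
  refine List.map_congr_left fun r _ => ?_
  rw [Function.comp_apply, wedgeMap_apply hc (hasWedge_barT_word _) (hasWedge_word_mul_word _ _)
    (hasWedge_barT_word _) (hasWedge_word_mul_word _ _), wedge_mul_comm D r.2]
  simp only [smul_mul_assoc, mul_smul_comm, smul_smul, mul_assoc]
  congr 1
  ring

lemma wedgeMap_gc3C {c : Coef} (hc : Supp c) (A B C D : List (Hsp g)) :
    wedgeMap g c (gc3C g (word A) (word B) (word C) (word D)) =
      unshuffleSum B.length (fun p q => unshuffleSum D.length fun r s =>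
        barSign p * barSign r * (-1) ^ (p * q + s * (C.length + r)) *
          c (A.length + q) p (s + C.length) r) • wedge4 A B C D := by
  rw [gc3C_word, map_list_sum, List.map_map]
  have houter := sum_unshuffles B (fun p q => unshuffleSum D.length fun r s =>
        barSign p * barSign r * (-1) ^ (p * q + s * (C.length + r)) *
          c (A.length + q) p (s + C.length) r)
    (LinearMap.mulLeft ℚ (wedge A) ∘ₗ LinearMap.mulRight ℚ (wedge C * wedge D))
  simp only [LinearMap.comp_apply, LinearMap.mulRight_apply, LinearMap.mulLeft_apply] at houter
  rw [wedge4, mul_assoc, mul_assoc, ← houter]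
  congr 1
  refine List.map_congr_left fun p _ => ?_
  have hinner := sum_unshuffles D (fun r s => barSign p.1.length * barSign r *
      (-1) ^ (p.1.length * p.2.length + s * (C.length + r)) *
        c (A.length + p.2.length) p.1.length (s + C.length) r)
    (LinearMap.mulLeft ℚ (wedge A * (wedge p.1 * wedge p.2) * wedge C))
  simp only [LinearMap.mulLeft_apply] at hinner
  have e : wedge A * (wedge p.1 * wedge p.2 * (wedge C * wedge D)) =
      wedge A * (wedge p.1 * wedge p.2) * wedge C * wedge D := by simp only [mul_assoc]
  rw [e, ← hinner, Function.comp_apply, map_list_sum, List.map_map]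
  congr 1
  refine List.map_congr_left fun r _ => ?_
  have h := wedge_mul_comm r.2 (C ++ r.1)
  rw [wedge_append, List.length_append] at h
  have e' : wedge A * (wedge p.2 * wedge p.1) * (wedge r.2 * (wedge C * wedge r.1)) =
      ((-1 : ℚ) ^ (p.1.length * p.2.length + r.2.length * (C.length + r.1.length))) •
        (wedge A * (wedge p.1 * wedge p.2) * wedge C * (wedge r.1 * wedge r.2)) := by
    rw [h, wedge_mul_comm p.2, mul_smul_comm, mul_smul_comm, smul_mul_assoc, smul_smul, ← pow_add,
      add_comm, mul_comm p.1.length]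
    simp only [mul_assoc]
  rw [Function.comp_apply, wedgeMap_apply hc (hasWedge_word_mul_word _ _) (hasWedge_barT_word _)
    (hasWedge_word_mul_word _ _) (hasWedge_barT_word _)]
  simp only [smul_mul_assoc, mul_smul_comm, smul_smul, mul_assoc] at e' ⊢
  rw [e', smul_smul]
  congr 1
  ring

lemma wedgeMap_gc3 {c : Coef} (hc : Supp c) (A B C D : List (Hsp g)) :
    wedgeMap g c (gc3 g (word A) (word B) (word C) (word D)) =
      gcThree c A.length B.length C.length D.length • wedge4 A B C D := by
  rw [gc3, map_add, map_add, wedgeMap_word hc, wedgeMap_gc3B hc, wedgeMap_gc3C hc, gcThree,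
    add_smul, add_smul]

lemma Th_mem_T4deg {i j k l m : ℕ} {t u v w : TA g} (ht : t ∈ TAdeg g i) (hu : u ∈ TAdeg g j)
    (hv : v ∈ TAdeg g k) (hw : w ∈ TAdeg g l) (h : i + j + k + l = m) :
    Th g t u v w ∈ T4deg g m :=
  Submodule.subset_span ⟨i, j, k, l, h, t, ht, u, hu, v, hv, w, hw, rfl⟩

lemma barT_word_mem (L : List (Hsp g)) : barT g (word L) ∈ TAdeg g L.length := by
  rw [barT_word]
  exact Submodule.smul_mem _ _ (by simpa using word_mem_TAdeg L.reverse)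

lemma word_mul_word_mem (L M : List (Hsp g)) :
    word L * word M ∈ TAdeg g (L.length + M.length) := by
  simpa [word_append] using word_mem_TAdeg (L ++ M)

lemma gc3_word_mem {m : ℕ} (A B C D : List (Hsp g))
    (h : A.length + B.length + C.length + D.length = m) :
    gc3 g (word A) (word B) (word C) (word D) ∈ T4deg g m := by
  rw [gc3, gc3B_word, gc3C_word]
  refine Submodule.add_mem _ (Submodule.add_mem _ ?_ ?_) ?_
  · exact Th_mem_T4deg (word_mem_TAdeg A) (word_mem_TAdeg B) (word_mem_TAdeg C)
      (word_mem_TAdeg D) h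
  all_goals
    refine list_sum_mem fun x hx => ?_
    obtain ⟨p, hp, rfl⟩ := List.mem_map.1 hx
    refine list_sum_mem fun x hx => ?_
    obtain ⟨r, hr, rfl⟩ := List.mem_map.1 hx
    have h1 := length_of_mem_unshuffles _ p hp
    have h2 := length_of_mem_unshuffles _ r hr
  · exact Th_mem_T4deg (barT_word_mem _) (word_mul_word_mem _ _) (barT_word_mem _)
      (word_mul_word_mem _ _) (by omega)
  · exact Th_mem_T4deg (word_mul_word_mem _ _) (barT_word_mem _) (word_mul_word_mem _ _)
      (barT_word_mem _) (by omega)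

end LambdaFour

namespace LambdaFour

variable {g : ℕ}

/-! ### The coefficient functions satisfying all relations -/

/-- The two-parameter family of coefficient functions satisfying all relations. -/
def sol (y z : ℚ) : Coef
  | 0, 0, 0, 4 => y
  | 0, 0, 1, 3 => -5 * z - 2 * y
  | 0, 0, 2, 2 => 2 * y
  | 0, 0, 3, 1 => -5 * z - 2 * y
  | 0, 0, 4, 0 => y
  | 0, 1, 0, 3 => y
  | 0, 1, 1, 2 => 3 * z
  | 0, 1, 2, 1 => 2 * z
  | 0, 1, 3, 0 => 5 * z
  | 0, 2, 0, 2 => y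
  | 0, 2, 1, 1 => 3 * z - 2 * y
  | 0, 2, 2, 0 => 2 * y
  | 0, 3, 0, 1 => y
  | 0, 3, 1, 0 => -5 * z
  | 0, 4, 0, 0 => y
  | 1, 0, 0, 3 => -5 * z
  | 1, 0, 1, 2 => -2 * z
  | 1, 0, 2, 1 => -3 * z
  | 1, 0, 3, 0 => -y
  | 1, 1, 0, 2 => -3 * z + 2 * y
  | 1, 1, 1, 1 => 4 * z - 2 * y
  | 1, 1, 2, 0 => -3 * z + 2 * y
  | 1, 2, 0, 1 => 3 * z
  | 1, 2, 1, 0 => -2 * z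
  | 1, 3, 0, 0 => 5 * z + 2 * y
  | 2, 0, 0, 2 => 2 * y
  | 2, 0, 1, 1 => 3 * z - 2 * y
  | 2, 0, 2, 0 => y
  | 2, 1, 0, 1 => 2 * z
  | 2, 1, 1, 0 => -3 * z
  | 2, 2, 0, 0 => 2 * y
  | 3, 0, 0, 1 => 5 * z
  | 3, 0, 1, 0 => -y
  | 3, 1, 0, 0 => 5 * z + 2 * y
  | 4, 0, 0, 0 => y
  | _, _, _, _ => 0

lemma supp_sol (y z : ℚ) : Supp (sol y z) := by
  intro i j k l h
  unfold sol
  split <;> first | rfl | exact absurd rfl h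

lemma sol_eq (y z : ℚ) :
    sol y z = fun i j k l => y * sol 1 0 i j k l + z * sol 0 1 i j k l := by
  funext i j k l
  unfold sol
  split <;> ring

lemma unshuffleSum_linear (n : ℕ) (y z : ℚ) (φ ψ : ℕ → ℕ → ℚ) :
    unshuffleSum n (fun p q => y * φ p q + z * ψ p q) =
      y * unshuffleSum n φ + z * unshuffleSum n ψ := by
  induction n generalizing φ ψ with
  | zero => rfl
  | succ n ih =>
    have h : ∀ p q, (-1) ^ p * (y * φ p (q + 1) + z * ψ p (q + 1)) =
        y * ((-1) ^ p * φ p (q + 1)) + z * ((-1) ^ p * ψ p (q + 1)) := fun p q => by ring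
    simp only [unshuffleSum, h, ih]
    ring

lemma gcThree_linear (y z : ℚ) (c d : Coef) (i j k l : ℕ) :
    gcThree (fun i j k l => y * c i j k l + z * d i j k l) i j k l =
      y * gcThree c i j k l + z * gcThree d i j k l := by
  have h : ∀ e a b : ℚ, e * (y * a + z * b) = y * (e * a) + z * (e * b) := fun e a b => by ring
  simp only [gcThree, h, unshuffleSum_linear]
  ring

/-- The coefficient function of the dumbbells determined by (CC) from that of the thetas. -/
def dumbbell (c : Coef) : Coef := fun i j k l => c i j k l + crossing c i j k l

lemma supp_dumbbell {c : Coef} (hc : Supp c) : Supp (dumbbell c) := by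
  intro i j k l h
  rw [dumbbell, crossing, hc _ _ _ _ h, hc k j i l (by omega)]
  simp

/-- A linear relation holds for the whole family as soon as it holds for the two generators. -/
lemma relation_sol (R : Coef → Coef)
    (hR : ∀ y z c d i j k l, R (fun i j k l => y * c i j k l + z * d i j k l) i j k l =
      y * R c i j k l + z * R d i j k l) (m : ℕ)
    (h : ∀ x ∈ quads m, R (sol 1 0) x.1 x.2.1 x.2.2.1 x.2.2.2 = 0 ∧
      R (sol 0 1) x.1 x.2.1 x.2.2.1 x.2.2.2 = 0) (y z : ℚ) {i j k l : ℕ}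
    (hm : i + j + k + l = m) : R (sol y z) i j k l = 0 := by
  rw [sol_eq, hR, (h _ (mem_quads.2 hm)).1, (h _ (mem_quads.2 hm)).2]
  simp

lemma gcThree_sol (y z : ℚ) {i j k l : ℕ} (h : i + j + k + l = 4) :
    gcThree (sol y z) i j k l = 0 :=
  relation_sol _ gcThree_linear 4 (by decide +kernel) y z h

lemma csSwap_sol (y z : ℚ) (i j k l : ℕ) : csSwap (sol y z) i j k l = 0 := by
  by_cases h : i + j + k + l = 4
  · exact relation_sol _ (fun _ _ _ _ _ _ _ _ => by simp only [csSwap]; ring) 4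
      (by decide +kernel) y z h
  · rw [csSwap, supp_sol _ _ _ _ _ _ h, supp_sol _ _ k l i j (by omega)]
    simp

lemma csFlip_sol (y z : ℚ) (i j k l : ℕ) : csFlip (sol y z) i j k l = 0 := by
  by_cases h : i + j + k + l = 4
  · exact relation_sol _ (fun _ _ _ _ _ _ _ _ => by simp only [csFlip]; ring) 4
      (by decide +kernel) y z h
  · rw [csFlip, supp_sol _ _ _ _ _ _ h, supp_sol _ _ j i l k (by omega)]
    simp

lemma hairBalance_of_supp {c : Coef} (hc : Supp c) {i j k l : ℕ} (h : i + j + k + l ≠ 3) :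
    hairBalance c i j k l = 0 := by
  rw [hairBalance, hc i j k (l + 1) (by omega), hc i j (k + 1) l (by omega),
    hc i (j + 1) k l (by omega), hc (i + 1) j k l (by omega)]
  simp

lemma hairBalance_sol (y z : ℚ) (i j k l : ℕ) : hairBalance (sol y z) i j k l = 0 := by
  by_cases h : i + j + k + l = 3
  · exact relation_sol _ (fun _ _ _ _ _ _ _ _ => by simp only [hairBalance]; ring) 3
      (by decide +kernel) y z h
  · exact hairBalance_of_supp (supp_sol y z) h

lemma dumbbell_crossing_sol (y z : ℚ) (i j k l : ℕ) :
    dumbbell (sol y z) i j k l - crossing (dumbbell (sol y z)) i j k l = 0 := by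
  by_cases h : i + j + k + l = 4
  · exact relation_sol (fun c i j k l => dumbbell c i j k l - crossing (dumbbell c) i j k l)
      (fun _ _ _ _ _ _ _ _ => by simp only [dumbbell, crossing]; ring) 4
      (by decide +kernel) y z h
  · rw [crossing, supp_dumbbell (supp_sol y z) _ _ _ _ h,
      supp_dumbbell (supp_sol y z) k j i l (by omega)]
    simp

lemma dumbbell_csFlip_sol (y z : ℚ) (i j k l : ℕ) :
    csFlip (dumbbell (sol y z)) i j k l = 0 := by
  by_cases h : i + j + k + l = 4
  · exact relation_sol (fun c => csFlip (dumbbell c))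
      (fun _ _ _ _ _ _ _ _ => by simp only [dumbbell, crossing, csFlip]; ring) 4
      (by decide +kernel) y z h
  · rw [csFlip, supp_dumbbell (supp_sol y z) _ _ _ _ h,
      supp_dumbbell (supp_sol y z) j i l k (by omega)]
    simp

lemma dumbbell_hairBalance_sol (y z : ℚ) (i j k l : ℕ) :
    hairBalance (dumbbell (sol y z)) i j k l = 0 := by
  by_cases h : i + j + k + l = 3
  · exact relation_sol (fun c => hairBalance (dumbbell c))
      (fun _ _ _ _ _ _ _ _ => by simp only [dumbbell, crossing, hairBalance]; ring) 3
      (by decide +kernel) y z h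
  · exact hairBalance_of_supp (supp_dumbbell (supp_sol y z)) h

end LambdaFour

namespace LambdaFour

variable {g : ℕ}

set_option maxRecDepth 20000

/-! ### The equivariant maps attached to the coefficient functions -/

lemma wedgeMap_csSwap_eq_zero {c : Coef} (hc : Supp c) (h : ∀ i j k l, csSwap c i j k l = 0)
    (t u v w : TA g) :
    wedgeMap g c (Th g t u v w - Th g (barT g v) (barT g w) (barT g t) (barT g u)) = 0 := by
  refine eq_zero_of_words (fun t u v w => wedgeMap g c
    (Th g t u v w - Th g (barT g v) (barT g w) (barT g t) (barT g u))) ?_ ?_ ?_ ?_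
    (fun A B C D => by rw [wedgeMap_csSwap hc, h, zero_smul]) t u v w
  all_goals
    refine fun _ _ _ => ⟨fun _ _ => ?_, fun _ _ => ?_⟩ <;>
      simp only [Th, map_add, map_sub, map_smul, add_tmul, tmul_add, tmul_smul, ← smul_tmul'] <;>
      module

lemma wedgeMap_csFlip_eq_zero {c : Coef} (hc : Supp c) (h : ∀ i j k l, csFlip c i j k l = 0)
    (t u v w : TA g) :
    wedgeMap g c (Th g t u v w - Th g (barT g u) (barT g t) (barT g w) (barT g v)) = 0 := by
  refine eq_zero_of_words (fun t u v w => wedgeMap g c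
    (Th g t u v w - Th g (barT g u) (barT g t) (barT g w) (barT g v))) ?_ ?_ ?_ ?_
    (fun A B C D => by rw [wedgeMap_csFlip hc, h, zero_smul]) t u v w
  all_goals
    refine fun _ _ _ => ⟨fun _ _ => ?_, fun _ _ => ?_⟩ <;>
      simp only [Th, map_add, map_sub, map_smul, add_tmul, tmul_add, tmul_smul, ← smul_tmul'] <;>
      module

lemma wedgeMap_crossing_eq_zero {c : Coef} (hc : Supp c)
    (h : ∀ i j k l, c i j k l - crossing c i j k l = 0) (t u v w : TA g) :
    wedgeMap g c (Th g t u v w - Th g (barT g v) u (barT g t) w) = 0 := by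
  refine eq_zero_of_words (fun t u v w => wedgeMap g c
    (Th g t u v w - Th g (barT g v) u (barT g t) w)) ?_ ?_ ?_ ?_
    (fun A B C D => by
      rw [map_sub, wedgeMap_word hc, wedgeMap_crossing hc, ← sub_smul, h, zero_smul]) t u v w
  all_goals
    refine fun _ _ _ => ⟨fun _ _ => ?_, fun _ _ => ?_⟩ <;>
      simp only [Th, map_add, map_sub, map_smul, add_tmul, tmul_add, tmul_smul, ← smul_tmul'] <;>
      module

lemma wedgeMap_dumbbell {c : Coef} (hc : Supp c) (t u v w : TA g) :
    wedgeMap g (dumbbell c) (Th g t u v w) - wedgeMap g c (Th g t u v w)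
      - wedgeMap g c (Th g (barT g v) u (barT g t) w) = 0 := by
  refine eq_zero_of_words (fun t u v w => wedgeMap g (dumbbell c) (Th g t u v w)
      - wedgeMap g c (Th g t u v w) - wedgeMap g c (Th g (barT g v) u (barT g t) w)) ?_ ?_ ?_ ?_
    (fun A B C D => by
      rw [wedgeMap_word hc, wedgeMap_word (supp_dumbbell hc), wedgeMap_crossing hc, dumbbell]
      module) t u v w
  all_goals
    refine fun _ _ _ => ⟨fun _ _ => ?_, fun _ _ => ?_⟩ <;>
      simp only [Th, map_add, map_smul, add_tmul, tmul_add, tmul_smul, ← smul_tmul'] <;>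
      module

lemma wedgeMap_hairBalance_eq_zero {c : Coef} (hc : Supp c)
    (h : ∀ i j k l, hairBalance c i j k l = 0) (t u v w : TA g) (a : Hsp g) :
    wedgeMap g c (Th g t u v (w * TensorAlgebra.ι ℚ a) - Th g t u (TensorAlgebra.ι ℚ a * v) w
      - Th g t (TensorAlgebra.ι ℚ a * u) v w + Th g (t * TensorAlgebra.ι ℚ a) u v w) = 0 := by
  refine eq_zero_of_words (fun t u v w => wedgeMap g c
    (Th g t u v (w * TensorAlgebra.ι ℚ a) - Th g t u (TensorAlgebra.ι ℚ a * v) w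
      - Th g t (TensorAlgebra.ι ℚ a * u) v w + Th g (t * TensorAlgebra.ι ℚ a) u v w)) ?_ ?_ ?_ ?_
    (fun A B C D => by rw [wedgeMap_hairBalance hc, h, zero_smul]) t u v w
  all_goals
    refine fun _ _ _ => ⟨fun _ _ => ?_, fun _ _ => ?_⟩ <;>
      simp only [Th, map_add, map_sub, map_smul, add_tmul, tmul_add, tmul_smul, ← smul_tmul',
        mul_add, add_mul, smul_mul_assoc, mul_smul_comm] <;>
      module

/-- The map on the presentation space attached to a coefficient function. -/
def presMap (g : ℕ) (c : Coef) : P2 g →ₗ[ℚ] ExteriorAlgebra ℚ (Hsp g) :=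
  (wedgeMap g c).coprod (wedgeMap g (dumbbell c))

lemma span_le_ker_presMap (y z : ℚ) :
    Submodule.span ℚ (C12Rel g) ≤ LinearMap.ker (presMap g (sol y z)) := by
  have hs := supp_sol y z
  have hd := supp_dumbbell hs
  rw [Submodule.span_le]
  rintro x (⟨t, u, v, w, rfl⟩ | ⟨t, u, v, w, rfl⟩ | ⟨t, u, v, w, rfl⟩ | ⟨t, u, v, w, rfl⟩ |
    ⟨t, u, v, w, a, rfl⟩ | ⟨t, u, v, w, a, rfl⟩ | ⟨t, u, v, w, rfl⟩) <;>
    simp only [SetLike.mem_coe, LinearMap.mem_ker, presMap, LinearMap.coprod_apply, ThP, DP,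
      map_zero, add_zero, zero_add, map_sub, map_add]
  · simpa only [map_sub, map_add] using wedgeMap_csSwap_eq_zero hs (csSwap_sol y z) t u v w
  · simpa only [map_sub, map_add] using wedgeMap_csFlip_eq_zero hs (csFlip_sol y z) t u v w
  · simpa only [map_sub, map_add] using
      wedgeMap_crossing_eq_zero hd (dumbbell_crossing_sol y z) t u v w
  · simpa only [map_sub, map_add] using wedgeMap_csFlip_eq_zero hd (dumbbell_csFlip_sol y z) t u v w
  · simpa only [map_sub, map_add] using
      wedgeMap_hairBalance_eq_zero hs (hairBalance_sol y z) t u v w a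
  · rw [← neg_eq_zero, ← wedgeMap_hairBalance_eq_zero hd (dumbbell_hairBalance_sol y z) t u v w a]
    simp only [map_add, map_sub]
    abel
  · rw [← wedgeMap_dumbbell hs t u v w]

/-- The map `C₁₂ → Λ⁴H` attached to the parameters `y`, `z`. -/
def solMap (g : ℕ) (y z : ℚ) : ↥(C12deg g 4) →ₗ[ℚ] ↥(⋀[ℚ]^4 (Hsp g)) :=
  LinearMap.codRestrict _
    ((Submodule.liftQ _ (presMap g (sol y z)) (span_le_ker_presMap y z)).domRestrict _) fun x => by
      obtain ⟨p, hp⟩ := Submodule.Quotient.mk_surjective _ x.1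
      rw [LinearMap.domRestrict_apply, ← hp, Submodule.liftQ_apply]
      exact Submodule.add_mem _ (wedgeMap_mem _ _) (wedgeMap_mem _ _)

lemma solMap_mk (y z : ℚ) (p : P2 g) (h : Submodule.Quotient.mk p ∈ C12deg g 4) :
    (solMap g y z ⟨Submodule.Quotient.mk p, h⟩ : ExteriorAlgebra ℚ (Hsp g)) =
      wedgeMap g (sol y z) p.1 + wedgeMap g (dumbbell (sol y z)) p.2 := rfl

lemma wedgeMap_T4map {c : Coef} (hc : Supp c) (φ : Hsp g →ₗ[ℚ] Hsp g) (x : T4 g) :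
    wedgeMap g c (T4map g φ x) = ExteriorAlgebra.map φ (wedgeMap g c x) := by
  have key : ∀ t u v w : TA g, wedgeMap g c (T4map g φ (Th g t u v w)) -
      ExteriorAlgebra.map φ (wedgeMap g c (Th g t u v w)) = 0 := by
    refine eq_zero_of_words (fun t u v w => wedgeMap g c (T4map g φ (Th g t u v w)) -
      ExteriorAlgebra.map φ (wedgeMap g c (Th g t u v w))) ?_ ?_ ?_ ?_ fun A B C D => ?_
    · refine fun _ _ _ => ⟨fun _ _ => ?_, fun _ _ => ?_⟩ <;>
        simp only [Th, map_add, map_smul, add_tmul, ← smul_tmul'] <;> module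
    · refine fun _ _ _ => ⟨fun _ _ => ?_, fun _ _ => ?_⟩ <;>
        simp only [Th, map_add, map_smul, add_tmul, tmul_add, tmul_smul, ← smul_tmul'] <;> module
    · refine fun _ _ _ => ⟨fun _ _ => ?_, fun _ _ => ?_⟩ <;>
        simp only [Th, map_add, map_smul, add_tmul, tmul_add, tmul_smul, ← smul_tmul'] <;> module
    · refine fun _ _ _ => ⟨fun _ _ => ?_, fun _ _ => ?_⟩ <;>
        simp only [Th, map_add, map_smul, tmul_add, tmul_smul] <;> module
    · have h : T4map g φ (Th g (word A) (word B) (word C) (word D)) =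
          Th g (word (A.map φ)) (word (B.map φ)) (word (C.map φ)) (word (D.map φ)) := by
        simp [T4map, Th, TAmap_word]
      rw [h, wedgeMap_word hc, wedgeMap_word hc]
      simp [wedge4, map_wedge]
  induction x using TensorProduct.induction_on with
  | zero => simp
  | add x y hx hy => simp only [map_add, hx, hy]
  | tmul t x =>
    induction x using TensorProduct.induction_on with
    | zero => simp
    | add x y hx hy => simp only [tmul_add, map_add, hx, hy]
    | tmul u x =>
      induction x using TensorProduct.induction_on with
      | zero => simp
      | add x y hx hy => simp only [tmul_add, map_add, hx, hy]
      | tmul v w => exact sub_eq_zero.1 (key t u v w)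

/-- A multilinear function of four tensors of given degrees vanishes if it does so on words in
basis vectors. -/
lemma eq_zero_of_basis_words {M : Type*} [AddCommGroup M] [Module ℚ M]
    (X : TA g → TA g → TA g → TA g → M)
    (h₁ : ∀ u v w, IsLinearMap ℚ fun t => X t u v w)
    (h₂ : ∀ t v w, IsLinearMap ℚ fun u => X t u v w)
    (h₃ : ∀ t u w, IsLinearMap ℚ fun v => X t u v w)
    (h₄ : ∀ t u v, IsLinearMap ℚ fun w => X t u v w) {i j k l : ℕ}
    (h : ∀ A B C D : List (Fin (2 * g)), A.length = i → B.length = j → C.length = k →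
      D.length = l → X (word (vecs A)) (word (vecs B)) (word (vecs C)) (word (vecs D)) = 0)
    {t u v w : TA g} (ht : t ∈ TAdeg g i) (hu : u ∈ TAdeg g j) (hv : v ∈ TAdeg g k)
    (hw : w ∈ TAdeg g l) : X t u v w = 0 := by
  have key : ∀ (n : ℕ) (f : TA g → M), IsLinearMap ℚ f →
      (∀ A : List (Fin (2 * g)), A.length = n → f (word (vecs A)) = 0) →
      ∀ t ∈ TAdeg g n, f t = 0 := by
    intro n f hf h0 t ht
    suffices hle : TAdeg g n ≤ LinearMap.ker (hf.mk' f) from hle ht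
    refine (TAdeg_le_span n).trans (Submodule.span_le.2 ?_)
    rintro _ ⟨A, hA, rfl⟩
    exact h0 A hA
  refine key i _ (h₁ u v w) (fun A hA => ?_) t ht
  refine key j _ (h₂ _ v w) (fun B hB => ?_) u hu
  refine key k _ (h₃ _ _ w) (fun C hC => ?_) v hv
  exact key l _ (h₄ _ _ _) (fun D hD => h A B C D hA hB hC hD) w hw

lemma wedgeMap_gc3_eq_zero {c : Coef} (hc : Supp c) {i j k l : ℕ} (h : gcThree c i j k l = 0)
    {t u v w : TA g} (ht : t ∈ TAdeg g i) (hu : u ∈ TAdeg g j) (hv : v ∈ TAdeg g k)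
    (hw : w ∈ TAdeg g l) : wedgeMap g c (gc3 g t u v w) = 0 := by
  have hl (x y : TA g) : LinearMap.mulLeft ℚ (x + y) =
      LinearMap.mulLeft ℚ x + LinearMap.mulLeft ℚ y := map_add (LinearMap.mul ℚ (TA g)) x y
  have hls (r : ℚ) (x : TA g) : LinearMap.mulLeft ℚ (r • x) = r • LinearMap.mulLeft ℚ x :=
    map_smul (LinearMap.mul ℚ (TA g)) r x
  have hr (x y : TA g) : LinearMap.mulRight ℚ (x + y) =
      LinearMap.mulRight ℚ x + LinearMap.mulRight ℚ y := map_add (LinearMap.mul ℚ (TA g)).flip x y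
  have hrs (r : ℚ) (x : TA g) : LinearMap.mulRight ℚ (r • x) = r • LinearMap.mulRight ℚ x :=
    map_smul (LinearMap.mul ℚ (TA g)).flip r x
  refine eq_zero_of_basis_words (fun t u v w => wedgeMap g c (gc3 g t u v w)) ?_ ?_ ?_ ?_
    (fun A B C D hA hB hC hD => by rw [wedgeMap_gc3 hc]; simp [hA, hB, hC, hD, h]) ht hu hv hw
  all_goals
    refine fun _ _ _ => ⟨fun _ _ => ?_, fun _ _ => ?_⟩ <;>
      simp only [gc3, gc3B, gc3C, Th, map_add, map_smul, add_tmul, tmul_add, tmul_smul,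
        ← smul_tmul', hl, hls, hr, hrs, TensorProduct.map_add_right, TensorProduct.map_smul_right,
        LinearMap.add_apply, LinearMap.smul_apply] <;>
      module

lemma solMap_mem (y z : ℚ) : solMap g y z ∈ equivC12toLamGC3 g := by
  refine ⟨fun σ p hx hy => ?_, fun i j k l h t ht u hu v hv w hw hmem => ?_⟩
  · rw [solMap_mk, solMap_mk, map_add, ← wedgeMap_T4map (supp_sol y z),
      ← wedgeMap_T4map (supp_dumbbell (supp_sol y z))]
    rfl
  · refine Subtype.ext ?_
    refine (solMap_mk y z (gc3 g t u v w, 0) hmem).trans ?_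
    rw [wedgeMap_gc3_eq_zero (supp_sol y z) (gcThree_sol y z h) ht hu hv hw]
    simp

end LambdaFour

namespace LambdaFour

variable {g : ℕ}

set_option maxRecDepth 20000

/-! ### Weights -/

/-- The diagonal automorphism of `H` with the given entries. -/
def diag (s : Fin (2 * g) → ℚˣ) : Hsp g ≃ₗ[ℚ] Hsp g :=
  LinearEquiv.piCongrRight fun i => LinearEquiv.smulOfUnit (s i)

lemma diag_single (s : Fin (2 * g) → ℚˣ) (i : Fin (2 * g)) :
    diag s (Pi.single i 1) = (s i : ℚ) • (Pi.single i 1 : Hsp g) := by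
  ext j
  rcases eq_or_ne j i with rfl | h
  · rw [diag, LinearEquiv.piCongrRight_apply, Pi.smul_apply, Pi.single_eq_same]
    rfl
  · simp [diag, h]

lemma word_map_diag (s : Fin (2 * g) → ℚˣ) (A : List (Fin (2 * g))) :
    word ((vecs A).map (diag s)) = ((A.map fun i => (s i : ℚ)).prod) • word (vecs A) := by
  induction A with
  | nil => simp [vecs]
  | cons a A ih =>
    simp only [vecs, List.map_cons, word_cons, List.prod_cons, diag_single] at ih ⊢
    rw [ih, map_smul, smul_mul_smul_comm]

lemma map_diag_wedge (s : Fin (2 * g) → ℚˣ) (A : List (Fin (2 * g))) :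
    ExteriorAlgebra.map (diag s).toLinearMap (wedge (vecs A)) =
      ((A.map fun i => (s i : ℚ)).prod) • wedge (vecs A) := by
  rw [map_wedge, ← toExterior_word, ← toExterior_word, ← map_smul, ← word_map_diag]
  rfl

/-- The standard basis of the fourth exterior power. -/
def lamBasis (g : ℕ) : Module.Basis (Set.powersetCard (Fin (2 * g)) 4) ℚ (⋀[ℚ]^4 (Hsp g)) :=
  (Pi.basisFun ℚ (Fin (2 * g))).exteriorPower 4

lemma lamBasis_eq_wedge (S : Set.powersetCard (Fin (2 * g)) 4) :
    ∃ A : List (Fin (2 * g)), A.length = 4 ∧ A.Nodup ∧ A.toFinset = S.1 ∧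
      (lamBasis g S : ExteriorAlgebra ℚ (Hsp g)) = wedge (vecs A) := by
  refine ⟨List.ofFn (Set.powersetCard.ofFinEmbEquiv.symm S), by simp, ?_, ?_, ?_⟩
  · rw [List.nodup_ofFn]
    exact (Set.powersetCard.ofFinEmbEquiv.symm S).injective
  · ext i
    rw [List.mem_toFinset, List.mem_ofFn]
    exact Set.powersetCard.mem_range_ofFinEmbEquiv_symm_iff_mem S i
  · rw [lamBasis, exteriorPower.basis_apply, exteriorPower.ιMulti_family_apply_coe,
      ExteriorAlgebra.ιMulti_family, ExteriorAlgebra.ιMulti_apply, wedge, vecs, List.map_ofFn,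
      List.map_ofFn]
    simp [Function.comp_def]

/-- An element of the fourth exterior power has weight `A` if the diagonal automorphisms act on it
as on the exterior product of the basis vectors with indices `A`. -/
def HasWeight (y : ⋀[ℚ]^4 (Hsp g)) (A : List (Fin (2 * g))) : Prop :=
  ∀ s : Fin (2 * g) → ℚˣ, ExteriorAlgebra.map (diag s).toLinearMap y.1 =
    ((A.map fun i => (s i : ℚ)).prod) • y.1

lemma repr_eq_of_hasWeight {y : ⋀[ℚ]^4 (Hsp g)} {A : List (Fin (2 * g))} (h : HasWeight y A)
    (s : Fin (2 * g) → ℚˣ) (S : Set.powersetCard (Fin (2 * g)) 4) :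
    (∏ i ∈ S.1, (s i : ℚ)) * (lamBasis g).repr y S =
      (A.map fun i => (s i : ℚ)).prod * (lamBasis g).repr y S := by
  have h1 : ∀ x : ⋀[ℚ]^4 (Hsp g), (exteriorPower.map 4 (diag s).toLinearMap x :
      ExteriorAlgebra ℚ (Hsp g)) = ExteriorAlgebra.map (diag s).toLinearMap x.1 := by
    intro x
    suffices hl : (⋀[ℚ]^4 (Hsp g)).subtype ∘ₗ exteriorPower.map 4 (diag s).toLinearMap =
        (ExteriorAlgebra.map (diag s).toLinearMap).toLinearMap ∘ₗ (⋀[ℚ]^4 (Hsp g)).subtype from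
      LinearMap.congr_fun hl x
    refine exteriorPower.linearMap_ext (AlternatingMap.ext fun v => ?_)
    simp only [LinearMap.compAlternatingMap_apply, LinearMap.comp_apply, Submodule.subtype_apply,
      exteriorPower.map_apply_ιMulti, exteriorPower.ιMulti_apply_coe, AlgHom.toLinearMap_apply,
      ExteriorAlgebra.map_apply_ιMulti]
  have h2 : ∀ x : ⋀[ℚ]^4 (Hsp g), (lamBasis g).repr (exteriorPower.map 4 (diag s).toLinearMap x) S =
      (∏ i ∈ S.1, (s i : ℚ)) * (lamBasis g).repr x S := by
    intro x
    suffices hl : (lamBasis g).coord S ∘ₗ exteriorPower.map 4 (diag s).toLinearMap =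
        (∏ i ∈ S.1, (s i : ℚ)) • (lamBasis g).coord S from LinearMap.congr_fun hl x
    refine (lamBasis g).ext fun T => ?_
    obtain ⟨B, -, hB, hT, hw⟩ := lamBasis_eq_wedge T
    have h3 : exteriorPower.map 4 (diag s).toLinearMap (lamBasis g T) =
        (∏ i ∈ T.1, (s i : ℚ)) • lamBasis g T := by
      refine Subtype.ext ?_
      rw [h1, SetLike.val_smul, hw, map_diag_wedge, ← hT, List.prod_toFinset _ hB]
    rw [LinearMap.comp_apply, h3, map_smul, LinearMap.smul_apply]
    rcases eq_or_ne S T with rfl | hne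
    · rfl
    · simp [hne.symm]
  have h4 : exteriorPower.map 4 (diag s).toLinearMap y =
      (A.map fun i => (s i : ℚ)).prod • y := Subtype.ext ((h1 y).trans (h s))
  rw [← h2, h4, map_smul, Finsupp.smul_apply, smul_eq_mul]

lemma nodup_of_hasWeight {y : ⋀[ℚ]^4 (Hsp g)} {A : List (Fin (2 * g))} (h : HasWeight y A)
    {S : Set.powersetCard (Fin (2 * g)) 4} (hS : (lamBasis g).repr y S ≠ 0) :
    A.Nodup ∧ A.toFinset = S.1 := by
  have key : ∀ a, A.count a = if a ∈ S.1 then 1 else 0 := by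
    intro a
    have h1 := mul_right_cancel₀ hS (repr_eq_of_hasWeight h
      (Function.update 1 a (Units.mk0 2 two_ne_zero)) S)
    have e : ∀ i, ((Function.update 1 a (Units.mk0 2 two_ne_zero) : Fin (2 * g) → ℚˣ) i : ℚ) =
        if i = a then 2 else 1 := by
      intro i
      rcases eq_or_ne i a with rfl | hi <;> simp [*]
    simp only [e, Finset.prod_ite_eq'] at h1
    have h2 : ∀ B : List (Fin (2 * g)), (B.map fun i => if i = a then (2 : ℚ) else 1).prod =
        2 ^ B.count a := by
      intro B
      induction B with
      | nil => simp
      | cons b B ih => by_cases hb : b = a <;> simp [ih, hb, pow_succ']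
    rw [h2] at h1
    refine pow_right_injective₀ (two_pos (α := ℚ)) (by norm_num) (h1.symm.trans ?_)
    split_ifs <;> simp
  constructor
  · rw [List.nodup_iff_count_le_one]
    intro a
    rw [key a]
    split_ifs <;> simp
  · ext a
    rw [List.mem_toFinset, ← List.count_pos_iff, key a]
    split_ifs with ha <;> simp [ha]

end LambdaFour

namespace LambdaFour

variable {g : ℕ}

set_option maxRecDepth 20000

/-! ### Equivariant maps on `T⊗T⊗T⊗T` -/

lemma T4map_Th_word (φ : Hsp g →ₗ[ℚ] Hsp g) (A B C D : List (Hsp g)) :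
    T4map g φ (Th g (word A) (word B) (word C) (word D)) =
      Th g (word (A.map φ)) (word (B.map φ)) (word (C.map φ)) (word (D.map φ)) := by
  simp [T4map, Th, TAmap_word]

lemma eq_zero_of_hasWeight {y : ⋀[ℚ]^4 (Hsp g)} {A : List (Fin (2 * g))} (h : HasWeight y A)
    (hA : ¬ A.Nodup) : y = 0 := by
  refine (lamBasis g).ext_elem fun S => ?_
  rw [map_zero, Finsupp.zero_apply]
  by_contra hS
  exact hA (nodup_of_hasWeight h hS).1

lemma eq_smul_of_hasWeight {y : ⋀[ℚ]^4 (Hsp g)} {A : List (Fin (2 * g))} (h : HasWeight y A)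
    {S : Set.powersetCard (Fin (2 * g)) 4} (hA : A.toFinset = S.1) :
    y = (lamBasis g).repr y S • lamBasis g S := by
  refine (lamBasis g).ext_elem fun T => ?_
  rw [map_smul, Finsupp.smul_apply, Module.Basis.repr_self, smul_eq_mul]
  rcases eq_or_ne S T with rfl | hne
  · simp
  · rw [Finsupp.single_eq_of_ne' hne, mul_zero]
    by_contra hT
    exact hne (Subtype.ext (hA.symm.trans (nodup_of_hasWeight h hT).2))

lemma wedge_eq_zero_of_not_nodup {A : List (Fin (2 * g))} (hl : A.length = 4) (hA : ¬ A.Nodup) :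
    wedge (vecs A) = 0 := by
  have hmem : wedge (vecs A) ∈ ⋀[ℚ]^4 (Hsp g) := by
    have := wedge_mem (vecs A)
    rwa [length_vecs, hl] at this
  exact congrArg Subtype.val (eq_zero_of_hasWeight (y := ⟨_, hmem⟩)
    (fun s => map_diag_wedge s A) hA)

lemma wedge4_vecs (A B C D : List (Fin (2 * g))) :
    wedge4 (vecs A) (vecs B) (vecs C) (vecs D) = wedge (vecs (A ++ B ++ C ++ D)) := by
  simp only [wedge4, vecs, wedge_append, List.map_append]

/-- The linear maps on `T⊗T⊗T⊗T` with values in the fourth exterior power that are equivariant in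
total degree `4`. -/
def IsEquivariant (F : T4 g →ₗ[ℚ] ↥(⋀[ℚ]^4 (Hsp g))) : Prop :=
  ∀ (σ : Hsp g ≃ₗ[ℚ] Hsp g), ∀ x ∈ T4deg g 4,
    (F (T4map g σ.toLinearMap x) : ExteriorAlgebra ℚ (Hsp g)) =
      ExteriorAlgebra.map σ.toLinearMap (F x : ExteriorAlgebra ℚ (Hsp g))

lemma Th_word_mem (A B C D : List (Hsp g))
    (h : A.length + B.length + C.length + D.length = 4) :
    Th g (word A) (word B) (word C) (word D) ∈ T4deg g 4 :=
  Th_mem_T4deg (word_mem_TAdeg A) (word_mem_TAdeg B) (word_mem_TAdeg C) (word_mem_TAdeg D) h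

lemma IsEquivariant.hasWeight {F : T4 g →ₗ[ℚ] ↥(⋀[ℚ]^4 (Hsp g))} (hF : IsEquivariant F)
    {A B C D : List (Fin (2 * g))} (h : A.length + B.length + C.length + D.length = 4) :
    HasWeight (F (Th g (word (vecs A)) (word (vecs B)) (word (vecs C)) (word (vecs D))))
      (A ++ B ++ C ++ D) := by
  intro s
  rw [← hF _ _ (Th_word_mem _ _ _ _ (by simpa using h)), T4map_Th_word]
  have hw (L : List (Fin (2 * g))) : word ((vecs L).map (diag s).toLinearMap) =
    ((L.map fun i => (s i : ℚ)).prod) • word (vecs L) := word_map_diag s L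
  simp only [hw, Th, ← TensorProduct.smul_tmul', TensorProduct.tmul_smul, smul_smul,
    List.map_append, List.prod_append]
  rw [map_smul, SetLike.val_smul]
  congr 1
  ring

lemma exists_perm_map_eq {α : Type*} {L M : List α} (hL : L.Nodup) (hM : M.Nodup)
    (h : L.length = M.length) : ∃ τ : Equiv.Perm α, L.map τ = M := by
  have := Equiv.Perm.isMultiplyPretransitive α L.length
  obtain ⟨τ, hτ⟩ := MulAction.exists_smul_eq (Equiv.Perm α)
    (⟨L.get, List.nodup_iff_injective_get.1 hL⟩ : Fin L.length ↪ α)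
    ⟨M.get ∘ Fin.cast h, (List.nodup_iff_injective_get.1 hM).comp (Fin.cast_injective h)⟩
  refine ⟨τ, List.ext_get (by simpa using h) fun n h₁ h₂ => ?_⟩
  have := DFunLike.congr_fun hτ ⟨n, by simpa using h₁⟩
  simpa using this

/-- The automorphism of `H` permuting the standard basis vectors. -/
def permEquiv (τ : Equiv.Perm (Fin (2 * g))) : Hsp g ≃ₗ[ℚ] Hsp g :=
  LinearEquiv.funCongrLeft ℚ ℚ τ.symm

lemma vecs_map_permEquiv (τ : Equiv.Perm (Fin (2 * g))) (A : List (Fin (2 * g))) :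
    (vecs A).map (permEquiv τ).toLinearMap = vecs (A.map τ) := by
  simp only [vecs, List.map_map]
  refine List.map_congr_left fun i _ => ?_
  ext j
  simp [permEquiv, LinearMap.funLeft, Pi.single_apply, Equiv.symm_apply_eq]

lemma exists_split {α : Type*} {L : List α} {i j k l : ℕ} (h : L.length = i + j + k + l) :
    ∃ A B C D : List α, A.length = i ∧ B.length = j ∧ C.length = k ∧ D.length = l ∧
      A ++ B ++ C ++ D = L := by
  refine ⟨L.take i, (L.drop i).take j, (L.drop (i + j)).take k, L.drop (i + j + k), ?_, ?_, ?_, ?_,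
    ?_⟩
  · simp; omega
  · simp; omega
  · simp; omega
  · simp; omega
  · simp [← List.drop_drop]

lemma exists_lamBasis_eq_wedge (hg : 2 ≤ g) :
    ∃ (L : List (Fin (2 * g))) (S : Set.powersetCard (Fin (2 * g)) 4), L.length = 4 ∧ L.Nodup ∧
      L.toFinset = S.1 ∧ (lamBasis g S : ExteriorAlgebra ℚ (Hsp g)) = wedge (vecs L) := by
  have h4 : 4 ≤ 2 * g := by omega
  have hS : (Finset.univ.map (Fin.castLEEmb h4)).card = 4 := by simp
  obtain ⟨L, hL⟩ := lamBasis_eq_wedge (g := g) ⟨_, hS⟩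
  exact ⟨L, _, hL⟩

/-- If `2 ≤ g`, some exterior product of four basis vectors does not vanish. -/
lemma exists_wedge_ne_zero (hg : 2 ≤ g) :
    ∃ L : List (Fin (2 * g)), L.length = 4 ∧ wedge (vecs L) ≠ 0 := by
  obtain ⟨L, S, hL, -, -, hw⟩ := exists_lamBasis_eq_wedge hg
  refine ⟨L, hL, hw ▸ fun h => (lamBasis g).ne_zero S (Subtype.ext h)⟩

/-- Linear maps on `T⊗T⊗T⊗T` that agree on words in the basis vectors agree in total degree `4`. -/
lemma eq_of_basis_words {M : Type*} [AddCommGroup M] [Module ℚ M] (P Q : T4 g →ₗ[ℚ] M)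
    (h : ∀ A B C D : List (Fin (2 * g)), A.length + B.length + C.length + D.length = 4 →
      P (Th g (word (vecs A)) (word (vecs B)) (word (vecs C)) (word (vecs D))) =
        Q (Th g (word (vecs A)) (word (vecs B)) (word (vecs C)) (word (vecs D))))
    {x : T4 g} (hx : x ∈ T4deg g 4) : P x = Q x := by
  suffices hle : T4deg g 4 ≤ LinearMap.ker (P - Q) from sub_eq_zero.1 (hle hx)
  rw [T4deg, Submodule.span_le]
  rintro _ ⟨i, j, k, l, hm, t, ht, u, hu, v, hv, w, hw, rfl⟩
  refine eq_zero_of_basis_words (fun t u v w => (P - Q) (Th g t u v w)) ?_ ?_ ?_ ?_ ?_ ht hu hv hw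
  iterate 4
    exact fun _ _ _ => ⟨fun _ _ => by simp only [Th, add_tmul, tmul_add, map_add],
      fun _ _ => by
        simp only [Th, ← TensorProduct.smul_tmul', TensorProduct.tmul_smul, map_smul]⟩
  rintro A B C D rfl rfl rfl rfl
  exact sub_eq_zero.2 (h A B C D hm)

/-- Equivariant maps on `T⊗T⊗T⊗T` are given in total degree `4` by a coefficient function. -/
lemma IsEquivariant.exists_coef (hg : 2 ≤ g) {F : T4 g →ₗ[ℚ] ↥(⋀[ℚ]^4 (Hsp g))}
    (hF : IsEquivariant F) : ∃ c, Supp c ∧ ∀ x ∈ T4deg g 4, (F x).1 = wedgeMap g c x := by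
  obtain ⟨L, S, hL, hLn, hLS, hw⟩ := exists_lamBasis_eq_wedge hg
  have key : ∀ i j k l, ∃ r : ℚ, (i + j + k + l ≠ 4 → r = 0) ∧ (i + j + k + l = 4 →
      ∃ A B C D : List (Fin (2 * g)), A.length = i ∧ B.length = j ∧ C.length = k ∧ D.length = l ∧
        A ++ B ++ C ++ D = L ∧
        (F (Th g (word (vecs A)) (word (vecs B)) (word (vecs C)) (word (vecs D)))).1 =
          r • wedge (vecs L)) := by
    intro i j k l
    by_cases h : i + j + k + l = 4
    · obtain ⟨A, B, C, D, rfl, rfl, rfl, rfl, hs⟩ := exists_split (hL.trans h.symm)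
      refine ⟨(lamBasis g).repr (F (Th g (word (vecs A)) (word (vecs B)) (word (vecs C))
        (word (vecs D)))) S, fun h' => absurd h h',
      fun _ => ⟨A, B, C, D, rfl, rfl, rfl, rfl, hs, ?_⟩⟩
      have hW := hF.hasWeight h
      rw [← hw]
      exact congrArg Subtype.val (eq_smul_of_hasWeight hW (S := S) (by rw [hs, hLS]))
    · exact ⟨0, fun _ => rfl, fun h' => absurd h' h⟩
  choose c hc0 hc using key
  have hword : ∀ A B C D : List (Fin (2 * g)), A.length + B.length + C.length + D.length = 4 →
      (F (Th g (word (vecs A)) (word (vecs B)) (word (vecs C)) (word (vecs D)))).1 =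
        wedgeMap g c (Th g (word (vecs A)) (word (vecs B)) (word (vecs C)) (word (vecs D))) := by
    intro A B C D h
    rw [wedgeMap_word hc0, wedge4_vecs]
    by_cases hn : (A ++ B ++ C ++ D).Nodup
    · obtain ⟨A', B', C', D', hA, hB, hC, hD, hs, hv⟩ := hc _ _ _ _ h
      obtain ⟨τ, hτ⟩ := exists_perm_map_eq hLn hn (by simp [hL]; omega)
      rw [← hs] at hτ
      simp only [List.map_append] at hτ
      obtain ⟨hABC, rfl⟩ := List.append_inj hτ (by simp [hA, hB, hC])
      obtain ⟨hAB, rfl⟩ := List.append_inj hABC (by simp [hA, hB])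
      obtain ⟨rfl, rfl⟩ := List.append_inj hAB (by simp [hA])
      have := hF (permEquiv τ) _ (Th_word_mem (vecs A') (vecs B') (vecs C') (vecs D')
        (by simpa using h))
      rw [T4map_Th_word, hv, map_smul, map_wedge] at this
      simp only [vecs_map_permEquiv] at this
      rw [this, ← hs]
      simp
    · rw [eq_zero_of_hasWeight (hF.hasWeight h) hn, wedge_eq_zero_of_not_nodup _ hn, smul_zero]
      · rfl
      · simpa [add_assoc] using h
  exact ⟨c, hc0, fun x hx =>
    eq_of_basis_words ((⋀[ℚ]^4 (Hsp g)).subtype ∘ₗ F) (wedgeMap g c) hword hx⟩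

end LambdaFour

namespace LambdaFour

variable {g : ℕ}

/-! ### Solving the linear relations -/

/-- The relations (CS), (HB) and (GC3) determine the coefficient function from two values. -/
lemma eq_sol {c : Coef} (hc : Supp c) (hs : ∀ i j k l, i + j + k + l = 4 → csSwap c i j k l = 0)
    (hf : ∀ i j k l, i + j + k + l = 4 → csFlip c i j k l = 0)
    (hb : ∀ i j k l, i + j + k + l = 3 → hairBalance c i j k l = 0)
    (hg : ∀ i j k l, i + j + k + l = 4 → gcThree c i j k l = 0) :
    c = sol (c 4 0 0 0) (c 0 1 3 0 / 5) := by
  have s₁ := hs 0 0 0 4 rfl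
  have s₂ := hs 0 0 1 3 rfl
  have s₃ := hs 0 0 2 2 rfl
  have s₄ := hs 0 0 3 1 rfl
  have s₅ := hs 0 0 4 0 rfl
  have s₆ := hs 0 1 0 3 rfl
  have s₇ := hs 0 1 1 2 rfl
  have s₈ := hs 0 1 2 1 rfl
  have s₉ := hs 0 1 3 0 rfl
  have s₁₀ := hs 0 2 1 1 rfl
  have s₁₁ := hs 0 2 2 0 rfl
  have s₁₂ := hs 0 3 1 0 rfl
  have s₁₃ := hs 1 0 1 2 rfl
  have s₁₄ := hs 1 0 2 1 rfl
  have s₁₅ := hs 1 0 3 0 rfl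
  have s₁₆ := hs 1 1 2 0 rfl
  have f₁ := hf 0 0 0 4 rfl
  have f₂ := hf 0 0 1 3 rfl
  have f₃ := hf 0 1 0 3 rfl
  have f₄ := hf 0 1 1 2 rfl
  have f₅ := hf 0 1 2 1 rfl
  have f₆ := hf 0 1 3 0 rfl
  have f₇ := hf 0 2 0 2 rfl
  have f₈ := hf 0 2 1 1 rfl
  have b₁ := hb 0 0 0 3 rfl
  have b₂ := hb 0 0 1 2 rfl
  have b₃ := hb 0 1 0 2 rfl
  have b₄ := hb 0 1 1 1 rfl
  have b₅ := hb 0 1 2 0 rfl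
  have g₁ := hg 0 0 0 4 rfl
  have g₂ := hg 0 2 2 0 rfl
  have g₃ := hg 0 1 1 2 rfl
  have g₄ := hg 1 1 1 1 rfl
  norm_num [csSwap, barSign] at s₁ s₂ s₃ s₄ s₅ s₆ s₇ s₈ s₉ s₁₀ s₁₁ s₁₂ s₁₃ s₁₄ s₁₅ s₁₆
  norm_num [csFlip, barSign] at f₁ f₂ f₃ f₄ f₅ f₆ f₇ f₈
  norm_num [hairBalance] at b₁ b₂ b₃ b₄ b₅
  norm_num [gcThree, unshuffleSum, barSign] at g₁ g₂ g₃ g₄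
  funext i j k l
  by_cases h : i + j + k + l = 4
  · obtain rfl : l = 4 - i - j - k := by omega
    have hi : i ≤ 4 := by omega
    have hj : j ≤ 4 := by omega
    have hk : k ≤ 4 := by omega
    interval_cases i <;> interval_cases j <;> interval_cases k <;>
      first | omega | rfl | (simp only [sol]; linarith)
  · rw [hc _ _ _ _ h, supp_sol _ _ _ _ _ _ h]

end LambdaFour

namespace LambdaFour

variable {g : ℕ}

set_option maxRecDepth 20000

/-! ### Classification of the equivariant maps -/

lemma TAmap_mem {φ : Hsp g →ₗ[ℚ] Hsp g} {n : ℕ} {t : TA g} (ht : t ∈ TAdeg g n) :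
    TAmap g φ t ∈ TAdeg g n := by
  suffices h : TAdeg g n ≤ (TAdeg g n).comap (TAmap g φ).toLinearMap from h ht
  refine (TAdeg_le_span n).trans (Submodule.span_le.2 ?_)
  rintro _ ⟨L, rfl, rfl⟩
  simpa [TAmap_word] using word_mem_TAdeg ((vecs L).map φ)

lemma T4map_mem {φ : Hsp g →ₗ[ℚ] Hsp g} {m : ℕ} {x : T4 g} (hx : x ∈ T4deg g m) :
    T4map g φ x ∈ T4deg g m := by
  suffices h : T4deg g m ≤ (T4deg g m).comap (T4map g φ) from h hx
  rw [T4deg, Submodule.span_le]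
  rintro _ ⟨i, j, k, l, h, t, ht, u, hu, v, hv, w, hw, rfl⟩
  exact Th_mem_T4deg (TAmap_mem ht) (TAmap_mem hu) (TAmap_mem hv) (TAmap_mem hw) h

lemma mk_mem_C12deg {p : P2 g} (h₁ : p.1 ∈ T4deg g 4) (h₂ : p.2 ∈ T4deg g 4) :
    (Submodule.Quotient.mk p : C12 g) ∈ C12deg g 4 :=
  Submodule.mem_map_of_mem (f := (Submodule.span ℚ (C12Rel g)).mkQ)
    (p := (T4deg g 4).prod (T4deg g 4)) ⟨h₁, h₂⟩

lemma coef_eq_zero {L : List (Fin (2 * g))} (hL : L.length = 4) (hw : wedge (vecs L) ≠ 0)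
    {r : ℚ} {i j k l : ℕ} (h : i + j + k + l = 4)
    (hr : ∀ A B C D : List (Fin (2 * g)), A.length = i → B.length = j → C.length = k →
      D.length = l → r • wedge4 (vecs A) (vecs B) (vecs C) (vecs D) = 0) : r = 0 := by
  obtain ⟨A, B, C, D, hA, hB, hC, hD, rfl⟩ := exists_split (hL.trans h.symm)
  have := hr A B C D hA hB hC hD
  rw [wedge4_vecs] at this
  exact (smul_eq_zero.1 this).resolve_right hw

/-- A coefficient function whose associated map kills the relations is in the family `sol`. -/
lemma eq_sol_of_wedgeMap (hg : 2 ≤ g) {c : Coef} (hc : Supp c)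
    (hrel : ∀ {x : T4 g}, x ∈ T4deg g 4 → ((x, 0) : P2 g) ∈ C12Rel g → wedgeMap g c x = 0)
    (hgc : ∀ A B C D : List (Fin (2 * g)), A.length + B.length + C.length + D.length = 4 →
      wedgeMap g c (gc3 g (word (vecs A)) (word (vecs B)) (word (vecs C)) (word (vecs D))) = 0) :
    c = sol (c 4 0 0 0) (c 0 1 3 0 / 5) := by
  obtain ⟨L, hL, hw⟩ := exists_wedge_ne_zero hg
  have hsw (i j k l : ℕ) (h : i + j + k + l = 4) : csSwap c i j k l = 0 := by
    refine coef_eq_zero hL hw h ?_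
    rintro A B C D rfl rfl rfl rfl
    have h0 := hrel (Submodule.sub_mem _ (Th_word_mem (vecs A) (vecs B) (vecs C) (vecs D)
      (by simpa using h)) (Th_mem_T4deg (barT_word_mem (vecs C)) (barT_word_mem (vecs D))
        (barT_word_mem (vecs A)) (barT_word_mem (vecs B)) (by simp; omega)))
      (Or.inl ⟨word (vecs A), word (vecs B), word (vecs C), word (vecs D),
        by simp [ThP]⟩)
    rw [wedgeMap_csSwap hc] at h0
    simpa using h0
  have hfl (i j k l : ℕ) (h : i + j + k + l = 4) : csFlip c i j k l = 0 := by
    refine coef_eq_zero hL hw h ?_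
    rintro A B C D rfl rfl rfl rfl
    have h0 := hrel (Submodule.sub_mem _ (Th_word_mem (vecs A) (vecs B) (vecs C) (vecs D)
      (by simpa using h)) (Th_mem_T4deg (barT_word_mem (vecs B)) (barT_word_mem (vecs A))
        (barT_word_mem (vecs D)) (barT_word_mem (vecs C)) (by simp; omega)))
      (Or.inr (Or.inl ⟨word (vecs A), word (vecs B), word (vecs C), word (vecs D),
        by simp [ThP]⟩))
    rw [wedgeMap_csFlip hc] at h0
    simpa using h0
  have hhb (i j k l : ℕ) (h : i + j + k + l = 3) : hairBalance c i j k l = 0 := by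
    refine coef_eq_zero hL hw (i := i) (j := j) (k := k) (l := l + 1) (by omega) ?_
    rintro A B C D' rfl rfl rfl hD'
    obtain ⟨D, a, rfl⟩ : ∃ D a, D' = D ++ [a] := by
      rcases D'.eq_nil_or_concat with rfl | ⟨D, a, rfl⟩
      · simp at hD'
      · exact ⟨D, a, by simp⟩
    obtain rfl : D.length = l := by simpa using hD'
    have hm (X : List (Fin (2 * g))) : word (vecs X) ∈ TAdeg g X.length := by
      simpa using word_mem_TAdeg (vecs X)
    have hr (X : List (Fin (2 * g))) : word (vecs X) * TensorAlgebra.ι ℚ (Pi.single a 1) ∈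
        TAdeg g (X.length + 1) := by
      simpa using word_mul_word_mem (vecs X) [Pi.single a 1]
    have hl (X : List (Fin (2 * g))) : TensorAlgebra.ι ℚ (Pi.single a 1) * word (vecs X) ∈
        TAdeg g (X.length + 1) := hm (a :: X)
    have h0 := hrel (Submodule.add_mem _ (Submodule.sub_mem _ (Submodule.sub_mem _
      (Th_mem_T4deg (hm A) (hm B) (hm C) (hr D) (by omega))
      (Th_mem_T4deg (hm A) (hm B) (hl C) (hm D) (by omega)))
      (Th_mem_T4deg (hm A) (hl B) (hm C) (hm D) (by omega)))
      (Th_mem_T4deg (hr A) (hm B) (hm C) (hm D) (by omega)))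
      (Or.inr (Or.inr (Or.inr (Or.inr (Or.inl ⟨word (vecs A), word (vecs B), word (vecs C),
        word (vecs D),
        Pi.single a 1, by simp [ThP]⟩)))))
    rw [wedgeMap_hairBalance hc] at h0
    simpa [vecs] using h0
  have hgc3 (i j k l : ℕ) (h : i + j + k + l = 4) : gcThree c i j k l = 0 := by
    refine coef_eq_zero hL hw h ?_
    rintro A B C D rfl rfl rfl rfl
    have h0 := hgc A B C D h
    rw [wedgeMap_gc3 hc] at h0
    simpa using h0
  exact eq_sol hc hsw hfl hhb hgc3

lemma exists_eq_solMap (hg : 2 ≤ g) {π : ↥(C12deg g 4) →ₗ[ℚ] ↥(⋀[ℚ]^4 (Hsp g))}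
    (hπ : π ∈ equivC12toLamGC3 g) : ∃ y z, π = solMap g y z := by
  obtain ⟨hequiv, hgc⟩ := hπ
  obtain ⟨ψ, hψ⟩ := LinearMap.exists_extend π
  let Ψ : P2 g →ₗ[ℚ] ↥(⋀[ℚ]^4 (Hsp g)) := ψ ∘ₗ (Submodule.span ℚ (C12Rel g)).mkQ
  have hΨ (p : P2 g) (h : Submodule.Quotient.mk p ∈ C12deg g 4) :
      π ⟨Submodule.Quotient.mk p, h⟩ = Ψ p :=
    (LinearMap.congr_fun hψ ⟨_, h⟩).symm
  have hrel (p : P2 g) (h : p ∈ C12Rel g) : Ψ p = 0 := by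
    have : (Submodule.span ℚ (C12Rel g)).mkQ p = 0 :=
      (Submodule.Quotient.mk_eq_zero _).2 (Submodule.subset_span h)
    rw [LinearMap.comp_apply, this, map_zero]
  let F : T4 g →ₗ[ℚ] ↥(⋀[ℚ]^4 (Hsp g)) := Ψ ∘ₗ LinearMap.inl ℚ _ _
  let G : T4 g →ₗ[ℚ] ↥(⋀[ℚ]^4 (Hsp g)) := Ψ ∘ₗ LinearMap.inr ℚ _ _
  have hFG (p : P2 g) : Ψ p = F p.1 + G p.2 := by
    rw [LinearMap.comp_apply Ψ, LinearMap.comp_apply Ψ, ← map_add]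
    simp
  have hF : IsEquivariant F := by
    intro σ x hx
    have hx' : (Submodule.Quotient.mk ((x, 0) : P2 g) : C12 g) ∈ C12deg g 4 :=
      mk_mem_C12deg hx (Submodule.zero_mem _)
    have hy' : (Submodule.Quotient.mk (P2map g σ.toLinearMap (x, 0)) : C12 g) ∈ C12deg g 4 :=
      mk_mem_C12deg (T4map_mem hx) (by simp [P2map])
    have := hequiv σ (x, 0) hx' hy'
    rw [hΨ, hΨ, hFG, hFG] at this
    simpa [P2map] using this
  obtain ⟨c, hc, hFc⟩ := hF.exists_coef hg
  have hF0 {x : T4 g} (hx : x ∈ T4deg g 4) (h : ((x, 0) : P2 g) ∈ C12Rel g) :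
      wedgeMap g c x = 0 := by
    rw [← hFc x hx]
    exact congrArg Subtype.val (hrel _ h)
  have hgc3 (A B C D : List (Fin (2 * g))) (h : A.length + B.length + C.length + D.length = 4) :
      wedgeMap g c (gc3 g (word (vecs A)) (word (vecs B)) (word (vecs C)) (word (vecs D))) = 0 := by
    have hm (X : List (Fin (2 * g))) : word (vecs X) ∈ TAdeg g X.length := by
      simpa using word_mem_TAdeg (vecs X)
    have hmem := gc3_word_mem (vecs A) (vecs B) (vecs C) (vecs D) (by simpa using h)
    rw [← hFc _ hmem]
    exact congrArg Subtype.val ((hΨ _ _).symm.trans (hgc _ _ _ _ h _ (hm A) _ (hm B) _ (hm C) _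
      (hm D) (mk_mem_C12deg hmem (Submodule.zero_mem _))))
  have hG {x : T4 g} (hx : x ∈ T4deg g 4) : (G x).1 = wedgeMap g (dumbbell c) x := by
    refine eq_of_basis_words ((⋀[ℚ]^4 (Hsp g)).subtype ∘ₗ G) _ (fun A B C D h => ?_) hx
    have h0 := hrel (DP g (word (vecs A)) (word (vecs B)) (word (vecs C)) (word (vecs D))
      - ThP g (word (vecs A)) (word (vecs B)) (word (vecs C)) (word (vecs D))
      - ThP g (barT g (word (vecs C))) (word (vecs B)) (barT g (word (vecs A))) (word (vecs D)))
      (Or.inr (Or.inr (Or.inr (Or.inr (Or.inr (Or.inr ⟨_, _, _, _, rfl⟩))))))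
    have h1 := congrArg Subtype.val h0
    rw [map_sub, map_sub, hFG, hFG (ThP _ _ _ _ _), hFG (ThP _ _ _ _ _)] at h1
    simp only [DP, ThP, map_zero, add_zero, zero_add, AddSubgroupClass.coe_sub,
      ZeroMemClass.coe_zero] at h1
    rw [hFc _ (Th_word_mem (vecs A) (vecs B) (vecs C) (vecs D) (by simpa using h)),
      hFc _ (Th_mem_T4deg (barT_word_mem (vecs C)) (word_mem_TAdeg (vecs B))
        (barT_word_mem (vecs A)) (word_mem_TAdeg (vecs D)) (by simp; omega)),
      ← wedgeMap_dumbbell hc (word (vecs A)) (word (vecs B)) (word (vecs C)) (word (vecs D))] at h1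
    exact sub_left_injective (sub_left_injective h1)
  refine ⟨c 4 0 0 0, c 0 1 3 0 / 5, LinearMap.ext ?_⟩
  rintro ⟨_, p, hp, rfl⟩
  refine Subtype.ext ?_
  refine Eq.trans ?_ (solMap_mk _ _ p _).symm
  rw [← eq_sol_of_wedgeMap hg hc hF0 hgc3, ← hFc _ hp.1, ← hG hp.2]
  exact congrArg Subtype.val ((hΨ p _).trans (hFG p))

end LambdaFour

namespace LambdaFour

variable {g : ℕ}

set_option maxRecDepth 20000

lemma wedgeMap_sol (y z : ℚ) :
    wedgeMap g (sol y z) = y • wedgeMap g (sol 1 0) + z • wedgeMap g (sol 0 1) := by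
  rw [sol_eq y z, wedgeMap_add, wedgeMap_smul, wedgeMap_smul]

lemma dumbbell_sol (y z : ℚ) :
    dumbbell (sol y z) = fun i j k l =>
      y * dumbbell (sol 1 0) i j k l + z * dumbbell (sol 0 1) i j k l := by
  rw [sol_eq y z]
  funext i j k l
  simp only [dumbbell, crossing]
  ring

lemma wedgeMap_dumbbell_sol (y z : ℚ) : wedgeMap g (dumbbell (sol y z)) =
    y • wedgeMap g (dumbbell (sol 1 0)) + z • wedgeMap g (dumbbell (sol 0 1)) := by
  rw [dumbbell_sol y z, wedgeMap_add, wedgeMap_smul, wedgeMap_smul]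

lemma coe_add_smul_apply {M N : Type*} [AddCommGroup M] [Module ℚ M] [AddCommGroup N] [Module ℚ N]
    {S : Submodule ℚ N} (y z : ℚ) (f f' : M →ₗ[ℚ] ↥S) (x : M) :
    (((y • f + z • f') x : ↥S) : N) = y • (f x : N) + z • (f' x : N) := rfl

lemma combine_apply {M N : Type*} [AddCommGroup M] [Module ℚ M] [AddCommGroup N] [Module ℚ N]
    (y z : ℚ) {f a b f' a' b' : M →ₗ[ℚ] N} (h : f = y • a + z • b) (h' : f' = y • a' + z • b')
    (p q : M) : f p + f' q = y • (a p + a' q) + z • (b p + b' q) := by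
  subst h h'
  simp only [LinearMap.add_apply, LinearMap.smul_apply]
  module

lemma solMap_eq (y z : ℚ) : solMap g y z = y • solMap g 1 0 + z • solMap g 0 1 := by
  refine LinearMap.ext ?_
  rintro ⟨_, p, hp, rfl⟩
  refine Subtype.ext (Eq.trans ?_ (coe_add_smul_apply y z (solMap g 1 0) (solMap g 0 1) _).symm)
  exact combine_apply y z (wedgeMap_sol y z) (wedgeMap_dumbbell_sol y z) p.1 p.2

lemma sol_eq_zero_of_solMap (hg : 2 ≤ g) {y z : ℚ} (h : solMap g y z = 0) {i j k l : ℕ}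
    (hm : i + j + k + l = 4) : sol y z i j k l = 0 := by
  obtain ⟨L, hL, hw⟩ := exists_wedge_ne_zero hg
  refine coef_eq_zero hL hw hm ?_
  rintro A B C D rfl rfl rfl rfl
  have hmem := mk_mem_C12deg (p := (Th g (word (vecs A)) (word (vecs B)) (word (vecs C))
    (word (vecs D)), 0)) (Th_word_mem _ _ _ _ (by simpa using hm)) (Submodule.zero_mem _)
  have h0 := solMap_mk y z _ hmem
  rw [h, map_zero, add_zero, wedgeMap_word (supp_sol y z)] at h0
  simpa using h0.symm

lemma finrank_eq_two_of_parametrization {M : Type*} [AddCommGroup M] [Module ℚ M]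
    {S : Submodule ℚ M} {f : ℚ → ℚ → M} (hf : ∀ y z, f y z = y • f 1 0 + z • f 0 1)
    (hmem : ∀ y z, f y z ∈ S) (hinj : ∀ y z, f y z = 0 → y = 0 ∧ z = 0)
    (hsurj : ∀ x ∈ S, ∃ y z, x = f y z) : Module.finrank ℚ ↥S = 2 := by
  have hli : LinearIndependent ℚ ![f 1 0, f 0 1] :=
    LinearIndependent.pair_iff.2 fun y z h => hinj y z ((hf y z).trans h)
  have hS : S = Submodule.span ℚ (Set.range ![f 1 0, f 0 1]) := by
    refine le_antisymm (fun x hx => ?_) (Submodule.span_le.2 ?_)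
    · obtain ⟨y, z, rfl⟩ := hsurj x hx
      rw [Matrix.range_cons_cons_empty, Submodule.mem_span_pair]
      exact ⟨y, z, (hf y z).symm⟩
    · rintro _ ⟨i, rfl⟩
      fin_cases i
      exacts [hmem 1 0, hmem 0 1]
  rw [hS, finrank_span_eq_card hli, Fintype.card_fin]

lemma eq_zero_of_solMap (hg : 2 ≤ g) {y z : ℚ} (h : solMap g y z = 0) : y = 0 ∧ z = 0 := by
  have hz : 5 * z = 0 := sol_eq_zero_of_solMap hg h (i := 0) (j := 1) (k := 3) (l := 0) rfl
  exact ⟨sol_eq_zero_of_solMap hg h (i := 4) (j := 0) (k := 0) (l := 0) rfl, by simpa using hz⟩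

end LambdaFour

/-- Dimensional form of Lemma 4.3: for every `g ≥ 2`, the space of `GL(H)`-equivariant
linear maps `π : C₁₂^{(4)} → Λ⁴H` with `π(GC3(t,u,v,w)) = 0` for all homogeneous
`t,u,v,w` of total degree `4` (i.e. those factoring through `Ω̃₂^{(4)}`) has
dimension `2`. -/
theorem multiplicity_of_lambda4_in_Omega2_degree6 (g : ℕ) (hg : 2 ≤ g) :
    Module.finrank ℚ ↥(equivC12toLamGC3 g) = 2 :=
  LambdaFour.finrank_eq_two_of_parametrization LambdaFour.solMap_eq LambdaFour.solMap_mem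
    (fun _ _ => LambdaFour.eq_zero_of_solMap hg) fun _ => LambdaFour.exists_eq_solMap hg
end
end

section
/- There exists G ≥ 1 such that for all g ≥ G: C₁₂^{(1)} = 0 and Ω̃₂^{(1)} = 0, i.e. the Lie-degree-3 parts of C_{1,2}ℋ and of the 2-loop space are zero. (The n = 3 row of Proposition 4.1 of the paper.) -/
open TensorProduct

set_option maxSynthPendingDepth 4

noncomputable section

/-- The antipode fixes the unit. -/
theorem barT_one (g : ℕ) : barT g 1 = 1 := by
  simp [barT]

/-- The antipode negates elements of degree one. -/
theorem barT_ι (g : ℕ) (a : Hsp g) :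
    barT g (TensorAlgebra.ι ℚ a) = -TensorAlgebra.ι ℚ a := by
  simp [barT]

/-- A subspace of `T⊗T⊗T⊗T` contains the degree-one part as soon as it contains the
generators carrying a single vector in one of the four slots. -/
theorem T4deg_one_le {g : ℕ} {N : Submodule ℚ (T4 g)}
    (h₁ : ∀ a, Th g (TensorAlgebra.ι ℚ a) 1 1 1 ∈ N)
    (h₂ : ∀ a, Th g 1 (TensorAlgebra.ι ℚ a) 1 1 ∈ N)
    (h₃ : ∀ a, Th g 1 1 (TensorAlgebra.ι ℚ a) 1 ∈ N)
    (h₄ : ∀ a, Th g 1 1 1 (TensorAlgebra.ι ℚ a) ∈ N) : T4deg g 1 ≤ N := by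
  have scalar : ∀ x ∈ TAdeg g 0, ∃ c : ℚ, x = c • (1 : TA g) := by
    intro x hx
    rw [TAdeg, pow_zero, Submodule.mem_one] at hx
    obtain ⟨c, rfl⟩ := hx
    exact ⟨c, Algebra.algebraMap_eq_smul_one c⟩
  have vector : ∀ x ∈ TAdeg g 1, ∃ a : Hsp g, x = TensorAlgebra.ι ℚ a := by
    intro x hx
    rw [TAdeg, pow_one] at hx
    obtain ⟨a, rfl⟩ := hx
    exact ⟨a, rfl⟩
  refine Submodule.span_le.2 ?_
  rintro _ ⟨i, j, k, l, hsum, t, ht, u, hu, v, hv, w, hw, rfl⟩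
  have hcases : (i = 1 ∧ j = 0 ∧ k = 0 ∧ l = 0) ∨ (i = 0 ∧ j = 1 ∧ k = 0 ∧ l = 0) ∨
      (i = 0 ∧ j = 0 ∧ k = 1 ∧ l = 0) ∨ (i = 0 ∧ j = 0 ∧ k = 0 ∧ l = 1) := by
    omega
  unfold Th at *
  rcases hcases with ⟨rfl, rfl, rfl, rfl⟩ | ⟨rfl, rfl, rfl, rfl⟩ | ⟨rfl, rfl, rfl, rfl⟩ |
    ⟨rfl, rfl, rfl, rfl⟩
  · obtain ⟨a, rfl⟩ := vector t ht
    obtain ⟨c, rfl⟩ := scalar u hu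
    obtain ⟨d, rfl⟩ := scalar v hv
    obtain ⟨e, rfl⟩ := scalar w hw
    simp only [TensorProduct.tmul_smul, ← TensorProduct.smul_tmul']
    exact N.smul_mem _ (N.smul_mem _ (N.smul_mem _ (h₁ a)))
  · obtain ⟨c, rfl⟩ := scalar t ht
    obtain ⟨a, rfl⟩ := vector u hu
    obtain ⟨d, rfl⟩ := scalar v hv
    obtain ⟨e, rfl⟩ := scalar w hw
    simp only [TensorProduct.tmul_smul, ← TensorProduct.smul_tmul']
    exact N.smul_mem _ (N.smul_mem _ (N.smul_mem _ (h₂ a)))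
  · obtain ⟨c, rfl⟩ := scalar t ht
    obtain ⟨d, rfl⟩ := scalar u hu
    obtain ⟨a, rfl⟩ := vector v hv
    obtain ⟨e, rfl⟩ := scalar w hw
    simp only [TensorProduct.tmul_smul, ← TensorProduct.smul_tmul']
    exact N.smul_mem _ (N.smul_mem _ (N.smul_mem _ (h₃ a)))
  · obtain ⟨c, rfl⟩ := scalar t ht
    obtain ⟨d, rfl⟩ := scalar u hu
    obtain ⟨e, rfl⟩ := scalar v hv
    obtain ⟨a, rfl⟩ := vector w hw
    simp only [TensorProduct.tmul_smul, ← TensorProduct.smul_tmul']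
    exact N.smul_mem _ (N.smul_mem _ (N.smul_mem _ (h₄ a)))

/-- The degree-one consequences of a reversal symmetry in the slots `1, 3`, of one in the
slots `1, 2` and `3, 4`, and of the relation (HB) force the degree-one part to vanish. -/
theorem T4deg_one_le_of_relations {g : ℕ} {N : Submodule ℚ (T4 g)}
    (h₁₃ : ∀ a, Th g (TensorAlgebra.ι ℚ a) 1 1 1 + Th g 1 1 (TensorAlgebra.ι ℚ a) 1 ∈ N)
    (h₁₂ : ∀ a, Th g (TensorAlgebra.ι ℚ a) 1 1 1 + Th g 1 (TensorAlgebra.ι ℚ a) 1 1 ∈ N)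
    (h₃₄ : ∀ a, Th g 1 1 (TensorAlgebra.ι ℚ a) 1 + Th g 1 1 1 (TensorAlgebra.ι ℚ a) ∈ N)
    (hHB : ∀ a, Th g 1 1 1 (TensorAlgebra.ι ℚ a) - Th g 1 1 (TensorAlgebra.ι ℚ a) 1
      - Th g 1 (TensorAlgebra.ι ℚ a) 1 1 + Th g (TensorAlgebra.ι ℚ a) 1 1 1 ∈ N) :
    T4deg g 1 ≤ N := by
  have key : ∀ a, Th g (TensorAlgebra.ι ℚ a) 1 1 1 ∈ N := by
    intro a
    have h := N.smul_mem (4⁻¹ : ℚ) (N.add_mem (N.sub_mem (N.add_mem (hHB a) (h₁₂ a)) (h₃₄ a))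
      (N.smul_mem (2 : ℚ) (h₁₃ a)))
    convert h using 1
    module
  have third : ∀ a, Th g 1 1 (TensorAlgebra.ι ℚ a) 1 ∈ N := fun a =>
    (N.add_mem_iff_right (key a)).1 (h₁₃ a)
  exact T4deg_one_le key (fun a => (N.add_mem_iff_right (key a)).1 (h₁₂ a)) third
    (fun a => (N.add_mem_iff_right (third a)).1 (h₃₄ a))

/-- The degree-one part of `T⊗T⊗T⊗T` lies in the span of the relations of `Ω̃₂`. -/
theorem T4deg_one_le_span_OmegaRel (g : ℕ) :
    T4deg g 1 ≤ Submodule.span ℚ (OmegaRel g) := by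
  refine T4deg_one_le_of_relations ?_ ?_ ?_ ?_ <;> intro a <;> apply Submodule.subset_span
  · refine Or.inl ⟨TensorAlgebra.ι ℚ a, 1, 1, 1, ?_⟩
    simp [barT_one, barT_ι, Th, TensorProduct.neg_tmul, TensorProduct.tmul_neg]
  · refine Or.inr (Or.inl ⟨TensorAlgebra.ι ℚ a, 1, 1, 1, ?_⟩)
    simp [barT_one, barT_ι, Th, TensorProduct.neg_tmul, TensorProduct.tmul_neg]
  · refine Or.inr (Or.inl ⟨1, 1, TensorAlgebra.ι ℚ a, 1, ?_⟩)
    simp [barT_one, barT_ι, Th, TensorProduct.tmul_neg]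
  · exact Or.inr (Or.inr (Or.inl ⟨1, 1, 1, 1, a, by simp⟩))

/-- The theta generators of degree one lie in the span of the relations of `C₁₂`. -/
theorem T4deg_one_le_comap_inl (g : ℕ) :
    T4deg g 1 ≤ (Submodule.span ℚ (C12Rel g)).comap (LinearMap.inl ℚ (T4 g) (T4 g)) := by
  refine T4deg_one_le_of_relations ?_ ?_ ?_ ?_ <;> intro a <;> apply Submodule.subset_span
  · refine Or.inl ⟨TensorAlgebra.ι ℚ a, 1, 1, 1, ?_⟩
    simp [barT_one, barT_ι, ThP, Th, TensorProduct.neg_tmul, TensorProduct.tmul_neg]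
  · refine Or.inr (Or.inl ⟨TensorAlgebra.ι ℚ a, 1, 1, 1, ?_⟩)
    simp [barT_one, barT_ι, ThP, Th, TensorProduct.neg_tmul, TensorProduct.tmul_neg]
  · refine Or.inr (Or.inl ⟨1, 1, TensorAlgebra.ι ℚ a, 1, ?_⟩)
    simp [barT_one, barT_ι, ThP, Th, TensorProduct.tmul_neg]
  · exact Or.inr (Or.inr (Or.inr (Or.inr (Or.inl ⟨1, 1, 1, 1, a, by simp [ThP]⟩))))

/-- The dumbbell generators of degree one lie in the span of the relations of `C₁₂`. -/
theorem T4deg_one_le_comap_inr (g : ℕ) :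
    T4deg g 1 ≤ (Submodule.span ℚ (C12Rel g)).comap (LinearMap.inr ℚ (T4 g) (T4 g)) := by
  refine T4deg_one_le_of_relations ?_ ?_ ?_ ?_ <;> intro a
  · refine Submodule.subset_span (Or.inr (Or.inr (Or.inl ⟨TensorAlgebra.ι ℚ a, 1, 1, 1, ?_⟩)))
    simp [barT_one, barT_ι, DP, Th, TensorProduct.neg_tmul, TensorProduct.tmul_neg]
  · refine Submodule.subset_span
      (Or.inr (Or.inr (Or.inr (Or.inl ⟨TensorAlgebra.ι ℚ a, 1, 1, 1, ?_⟩))))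
    simp [barT_one, barT_ι, DP, Th, TensorProduct.neg_tmul, TensorProduct.tmul_neg]
  · refine Submodule.subset_span
      (Or.inr (Or.inr (Or.inr (Or.inl ⟨1, 1, TensorAlgebra.ι ℚ a, 1, ?_⟩))))
    simp [barT_one, barT_ι, DP, Th, TensorProduct.tmul_neg]
  · rw [← Submodule.neg_mem_iff]
    refine Submodule.subset_span
      (Or.inr (Or.inr (Or.inr (Or.inr (Or.inr (Or.inl ⟨1, 1, 1, 1, a, ?_⟩))))))
    simp only [DP, one_mul, mul_one, LinearMap.inr_apply, Prod.mk_sub_mk, Prod.mk_add_mk,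
      sub_zero, add_zero, Prod.mk.injEq, true_and]
    abel

/-- The `n = 3` row of Proposition 4.1: stably, the Lie-degree-3 parts of `C_{1,2}ℋ`
and of the 2-loop space `Ω̃₂` vanish. -/
theorem c12_and_omega2_degree3_vanish :
    ∃ G : ℕ, 1 ≤ G ∧ ∀ g : ℕ, G ≤ g → C12deg g 1 = ⊥ ∧ Omega2deg g 1 = ⊥ := by
  refine ⟨1, le_rfl, fun g _ => ⟨?_, ?_⟩⟩
  · rw [C12deg, Submodule.eq_bot_iff]
    rintro _ ⟨⟨x, y⟩, ⟨hx, hy⟩, rfl⟩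
    rw [Submodule.mkQ_apply, Submodule.Quotient.mk_eq_zero]
    have hx' : (x, 0) ∈ Submodule.span ℚ (C12Rel g) := T4deg_one_le_comap_inl g hx
    have hy' : (0, y) ∈ Submodule.span ℚ (C12Rel g) := T4deg_one_le_comap_inr g hy
    simpa using Submodule.add_mem _ hx' hy'
  · rw [Omega2deg, Submodule.eq_bot_iff]
    rintro _ ⟨x, hx, rfl⟩
    rw [Submodule.mkQ_apply, Submodule.Quotient.mk_eq_zero]
    exact T4deg_one_le_span_OmegaRel g hx
end
end
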